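/- arXiv:2206.06538 — 2 statements merged into one kernel-verified Lean document; each statement's English description precedes it below -/
import Mathlib

section
/- Let [u,w] be a Bruhat interval in a Weyl group W and [u',w'] a Bruhat interval in a Weyl group W'. If [u,w] and [u',w'] are isomorphic as posets and [u,w] is rationally smooth, then [u',w'] is rationally smooth. -/
namespace Paper

/-! ### Bruhat order on a Coxeter group -/

variable {B W : Type*} [Group W] {M : CoxeterMatrix B}

/-- One step in the Bruhat order: multiply on the left by a reflection,
increasing the length. -/
def BruhatStep (cs : CoxeterSystem M W) (a b : W) : Prop :=
  ∃ t : W, cs.IsReflection t ∧ b = t * a ∧ cs.length a < cs.length b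

/-- The Bruhat order on a Coxeter group. -/
def BruhatLE (cs : CoxeterSystem M W) : W → W → Prop :=
  Relation.ReflTransGen (BruhatStep cs)

theorem BruhatLE.length_le {cs : CoxeterSystem M W} {a b : W} (h : BruhatLE cs a b) :
    cs.length a ≤ cs.length b := by
  induction h with
  | refl => exact le_rfl
  | tail _ h ih => obtain ⟨t, -, -, hlt⟩ := h; exact ih.trans hlt.le

theorem BruhatLE.length_lt {cs : CoxeterSystem M W} {a b : W} (h : BruhatLE cs a b)
    (hne : a ≠ b) : cs.length a < cs.length b := by
  rcases Relation.ReflTransGen.cases_head h with h' | ⟨c, hc, h'⟩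
  · exact absurd h' hne
  · obtain ⟨t, -, -, hlt⟩ := hc
    exact lt_of_lt_of_le hlt (BruhatLE.length_le h')

theorem BruhatLE.antisymm {cs : CoxeterSystem M W} {a b : W} (h1 : BruhatLE cs a b)
    (h2 : BruhatLE cs b a) : a = b := by
  by_contra hne
  exact absurd (BruhatLE.length_lt h1 hne) (not_lt.mpr (BruhatLE.length_le h2))

/-- The Bruhat interval `[u,w]`, as a type. -/
abbrev BruhatInterval (cs : CoxeterSystem M W) (u w : W) : Type _ :=
  {y : W // BruhatLE cs u y ∧ BruhatLE cs y w}

/-- The Bruhat interval `[u,w]` is a poset under the Bruhat order. -/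
instance (cs : CoxeterSystem M W) (u w : W) : PartialOrder (BruhatInterval cs u w) where
  le a b := BruhatLE cs a.1 b.1
  le_refl _ := Relation.ReflTransGen.refl
  le_trans _ _ _ := Relation.ReflTransGen.trans
  le_antisymm _ _ h1 h2 := Subtype.ext (BruhatLE.antisymm h1 h2)

/-- A principal order ideal `{v : v ≤ x}` of the Bruhat order, as a type. -/
abbrev BruhatIdeal (cs : CoxeterSystem M W) (x : W) : Type _ :=
  {v : W // BruhatLE cs v x}

/-- A principal order ideal of the Bruhat order is a poset under the Bruhat order. -/
instance (cs : CoxeterSystem M W) (x : W) : PartialOrder (BruhatIdeal cs x) where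
  le a b := BruhatLE cs a.1 b.1
  le_refl _ := Relation.ReflTransGen.refl
  le_trans _ _ _ := Relation.ReflTransGen.trans
  le_antisymm _ _ h1 h2 := Subtype.ext (BruhatLE.antisymm h1 h2)

/-! ### Posets: matchings, special matchings and zircons -/

/-- A matching of a poset: an involution matching each element with an element
covering it or covered by it. -/
def IsMatching {α : Type*} [PartialOrder α] (f : α → α) : Prop :=
  Function.Involutive f ∧ ∀ x : α, f x ⋖ x ∨ x ⋖ f x

/-- A special matching of a poset. -/
def IsSpecialMatching {α : Type*} [PartialOrder α] (f : α → α) : Prop :=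
  IsMatching f ∧ ∀ x y : α, x ⋖ y → f x = y ∨ f x < f y

/-- A zircon: a poset in which the principal order ideal of every non-minimal element is
finite and has a special matching. -/
def IsZircon (α : Type*) [PartialOrder α] : Prop :=
  ∀ x : α, (∃ y : α, y < x) →
    ({v : α | v ≤ x}.Finite ∧
      ∃ f : {v : α // v ≤ x} → {v : α // v ≤ x}, IsSpecialMatching f)

/-- The degree of `v` in the Bruhat graph of the interval `[u,w]`: the number of `y ∈ [u,w]`
such that `v⁻¹ * y` is a reflection. -/
noncomputable def bruhatDeg (cs : CoxeterSystem M W) (u w v : W) : ℕ :=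
  Nat.card {y : W // (BruhatLE cs u y ∧ BruhatLE cs y w) ∧ cs.IsReflection (v⁻¹ * y)}

/-- A Bruhat interval `[u,w]` is rationally smooth if `deg_{y,w}(y) = ℓ(w) - ℓ(y)` for all
`y ∈ [u,w]` (Carrell–Peterson). -/
def RationallySmooth (cs : CoxeterSystem M W) (u w : W) : Prop :=
  ∀ y : W, BruhatLE cs u y → BruhatLE cs y w →
    bruhatDeg cs y w y = cs.length w - cs.length y

/-! ### Root systems with a height functional -/

/-- A faithful root representation of a group: an invariant symmetric
form, a finite stable set of roots of norm two, and a linear functional that vanishes on no root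
and thus separates positive from negative roots. -/
structure RootRep (W V : Type*) [Group W] [AddCommGroup V] [Module ℝ V] where
  /-- the action -/
  ρ : W →* Module.End ℝ V
  /-- the invariant form -/
  form : V →ₗ[ℝ] V →ₗ[ℝ] ℝ
  /-- the functional whose sign decides positivity -/
  ht : V →ₗ[ℝ] ℝ
  /-- the roots -/
  roots : Set V
  finite_roots : roots.Finite
  neg_mem : ∀ α ∈ roots, -α ∈ roots
  map_mem : ∀ w, ∀ α ∈ roots, ρ w α ∈ roots
  form_symm : ∀ x y, form x y = form y x
  form_map : ∀ w x y, form (ρ w x) (ρ w y) = form x y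
  form_self : ∀ α ∈ roots, form α α = 2
  ht_ne_zero : ∀ α ∈ roots, ht α ≠ 0
  injective : Function.Injective ρ
  /-- the determinant character -/
  sign : W →* ℤˣ
  sign_reflection : ∀ t, ∀ α ∈ roots, (∀ v, ρ t v = v - form v α • α) → sign t = -1

namespace RootRep

variable {V : Type*} [AddCommGroup V] [Module ℝ V] (R : RootRep W V)

/-- `t` acts as the reflection in the root `α`. -/
def IsReflectionAt (t : W) (α : V) : Prop := ∀ v, R.ρ t v = v - R.form v α • α

/-- The positive roots in `P` made negative by `w`. -/
def inversions (P : Submodule ℝ V) (w : W) : Set V :=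
  {α | α ∈ R.roots ∧ α ∈ P ∧ 0 < R.ht α ∧ R.ht (R.ρ w α) < 0}

/-- The number of positive roots in `P` made negative by `w`. -/
noncomputable def rank (P : Submodule ℝ V) (w : W) : ℕ := (R.inversions P w).ncard

variable {R} {P : Submodule ℝ V} {t w z : W} {α β γ δ : V}

theorem ρ_mul (x y : W) (v : V) : R.ρ (x * y) v = R.ρ x (R.ρ y v) := by
  rw [map_mul]; rfl

theorem ρ_apply_inv (x : W) (v : V) : R.ρ x (R.ρ x⁻¹ v) = v := by
  rw [← ρ_mul, mul_inv_cancel, map_one]; rfl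

theorem ext_ρ {x y : W} (h : ∀ v, R.ρ x v = R.ρ y v) : x = y :=
  R.injective (LinearMap.ext h)

theorem finite_inversions : (R.inversions P w).Finite :=
  R.finite_roots.subset fun _ h => h.1

theorem root_ne_zero (hα : α ∈ R.roots) : α ≠ 0 := by
  rintro rfl
  exact R.ht_ne_zero _ hα (map_zero _)

theorem ht_neg_of_not_pos (hα : α ∈ R.roots) (h : ¬ 0 < R.ht α) : R.ht α < 0 :=
  lt_of_le_of_ne (not_lt.mp h) (R.ht_ne_zero _ hα)

/-- Proportional positive roots are equal. -/
theorem eq_of_smul (hα : α ∈ R.roots) (hβ : β ∈ R.roots) (hα0 : 0 < R.ht α) (hβ0 : 0 < R.ht β)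
    {c : ℝ} (h : α = c • β) : α = β := by
  have h1 := R.form_self _ hα
  have h2 := R.form_self _ hβ
  rw [h] at h1 hα0
  simp only [map_smul, LinearMap.smul_apply, smul_eq_mul, h2] at h1 hα0
  have hc : 0 < c := pos_of_mul_pos_left hα0 hβ0.le
  have : c = 1 := by nlinarith
  rw [h, this, one_smul]

theorem coeffs_eq_zero (hα : α ∈ R.roots) (hβ : β ∈ R.roots) (hα0 : 0 < R.ht α)
    (hβ0 : 0 < R.ht β) (hne : α ≠ β) {c d : ℝ} (h : c • α + d • β = 0) : c = 0 ∧ d = 0 := by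
  have hc : c = 0 := by
    by_contra hc
    refine hne (eq_of_smul hα hβ hα0 hβ0 (c := -(c⁻¹ * d)) ?_)
    have h2 : c⁻¹ • (c • α + d • β) = 0 := by rw [h, smul_zero]
    rw [smul_add, smul_smul, smul_smul, inv_mul_cancel₀ hc, one_smul] at h2
    rw [neg_smul, ← eq_neg_of_add_eq_zero_left h2]
  refine ⟨hc, ?_⟩
  rw [hc, zero_smul, zero_add] at h
  exact (smul_eq_zero.mp h).resolve_right (root_ne_zero hβ)

namespace IsReflectionAt

theorem apply_self (ht : R.IsReflectionAt t α) (hα : α ∈ R.roots) : R.ρ t α = -α := by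
  rw [ht, R.form_self _ hα, two_smul]; abel

theorem mul_self (ht : R.IsReflectionAt t α) (hα : α ∈ R.roots) : t * t = 1 := by
  refine R.ext_ρ fun v => ?_
  rw [ρ_mul, ht v, map_sub, map_smul, ht.apply_self hα, ht v, map_one, Module.End.one_apply]
  simp

theorem inv (ht : R.IsReflectionAt t α) (hα : α ∈ R.roots) : t⁻¹ = t :=
  inv_eq_of_mul_eq_one_left (ht.mul_self hα)

theorem apply_apply (ht : R.IsReflectionAt t α) (hα : α ∈ R.roots) (v : V) :
    R.ρ t (R.ρ t v) = v := by
  rw [← ρ_mul, ht.mul_self hα, map_one]; rfl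

theorem neg (ht : R.IsReflectionAt t α) : R.IsReflectionAt t (-α) := fun v => by
  rw [ht v]; simp

theorem conj (ht : R.IsReflectionAt t α) (w : W) :
    R.IsReflectionAt (w * t * w⁻¹) (R.ρ w α) := fun v => by
  rw [ρ_mul, ρ_mul, ht, map_sub, map_smul, ρ_apply_inv, ← R.form_map w, ρ_apply_inv]

theorem unique {t' : W} (ht : R.IsReflectionAt t α) (ht' : R.IsReflectionAt t' α) : t = t' :=
  R.ext_ρ fun v => by rw [ht, ht']

theorem apply_mem (ht : R.IsReflectionAt t α) (hα : α ∈ P) (hγ : γ ∈ P) : R.ρ t γ ∈ P := by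
  rw [ht]; exact P.sub_mem hγ (P.smul_mem _ hα)

/-- Reflecting in a positive root the wrong way round strictly increases the rank, with room for
any set `E` of new inversions that are not inherited from `z`. -/
theorem rank_add_ncard_le (ht : R.IsReflectionAt t β) (hβ : β ∈ R.roots) (hβP : β ∈ P)
    (hβ0 : 0 < R.ht β) (hz : 0 < R.ht (R.ρ z β)) {E : Set V} (hE : E ⊆ R.inversions P (z * t))
    (hE' : ∀ α ∈ E, R.ht (R.ρ t α) < 0 ∧ 0 < R.ht (R.ρ z α)) :
    R.rank P z + E.ncard ≤ R.rank P (z * t) := by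
  classical
  have hcoef : ∀ δ, 0 < R.ht δ → R.ht (R.ρ t δ) < 0 → 0 < R.form δ β := by
    intro δ h1 h2
    rw [ht, map_sub, map_smul, smul_eq_mul] at h2
    exact pos_of_mul_pos_left (by linarith) hβ0.le
  let F : V → V := fun δ => if 0 < R.ht (R.ρ t δ) then R.ρ t δ else δ
  have hF : ∀ δ ∈ R.inversions P z, F δ ∈ R.inversions P (z * t) := by
    rintro δ ⟨h1, h2, h3, h4⟩
    by_cases h : 0 < R.ht (R.ρ t δ)
    · simp only [F, if_pos h]
      exact ⟨R.map_mem _ _ h1, ht.apply_mem hβP h2, h, by rwa [ρ_mul, ht.apply_apply hβ]⟩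
    · simp only [F, if_neg h]
      refine ⟨h1, h2, h3, ?_⟩
      have := hcoef δ h3 (ht_neg_of_not_pos (R.map_mem _ _ h1) h)
      rw [ρ_mul, ht, map_sub, map_sub, map_smul, map_smul, smul_eq_mul]
      nlinarith
  have hinj : Set.InjOn F (R.inversions P z) := by
    have key : ∀ δ ∈ R.inversions P z, ∀ ε ∈ R.inversions P z, 0 < R.ht (R.ρ t δ) →
        ¬ 0 < R.ht (R.ρ t ε) → R.ρ t δ ≠ ε := by
      rintro δ hδ ε hε h1 h2 rfl
      rw [ht.apply_apply hβ] at h2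
      exact h2 hδ.2.2.1
    intro δ hδ ε hε h
    by_cases h1 : 0 < R.ht (R.ρ t δ) <;> by_cases h2 : 0 < R.ht (R.ρ t ε)
    · simp only [F, if_pos h1, if_pos h2] at h
      rw [← ht.apply_apply hβ δ, h, ht.apply_apply hβ]
    · simp only [F, if_pos h1, if_neg h2] at h
      exact absurd h (key δ hδ ε hε h1 h2)
    · simp only [F, if_neg h1, if_pos h2] at h
      exact absurd h.symm (key ε hε δ hδ h2 h1)
    · simpa only [F, if_neg h1, if_neg h2] using h
  have hdisj : Disjoint (F '' R.inversions P z) E := by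
    rw [Set.disjoint_left]
    rintro _ ⟨δ, hδ, rfl⟩ hmem
    obtain ⟨h1, h2⟩ := hE' _ hmem
    by_cases h : 0 < R.ht (R.ρ t δ)
    · simp only [F, if_pos h, ht.apply_apply hβ] at h1
      exact absurd hδ.2.2.1 (not_lt.mpr h1.le)
    · simp only [F, if_neg h] at h2
      exact absurd hδ.2.2.2 (not_lt.mpr h2.le)
  have hsub : F '' R.inversions P z ∪ E ⊆ R.inversions P (z * t) := by
    rintro _ (⟨δ, hδ, rfl⟩ | h)
    · exact hF δ hδ
    · exact hE h
  calc R.rank P z + E.ncard = (F '' R.inversions P z).ncard + E.ncard := by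
        rw [hinj.ncard_image]; rfl
    _ = (F '' R.inversions P z ∪ E).ncard :=
        (Set.ncard_union_eq hdisj (finite_inversions.image _)
          (finite_inversions.subset hE)).symm
    _ ≤ R.rank P (z * t) := Set.ncard_le_ncard hsub finite_inversions

theorem self_mem_inversions (ht : R.IsReflectionAt t β) (hβ : β ∈ R.roots) (hβP : β ∈ P)
    (hβ0 : 0 < R.ht β) (hz : 0 < R.ht (R.ρ z β)) : β ∈ R.inversions P (z * t) :=
  ⟨hβ, hβP, hβ0, by rw [ρ_mul, ht.apply_self hβ, map_neg, map_neg]; linarith⟩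

theorem rank_lt (ht : R.IsReflectionAt t β) (hβ : β ∈ R.roots) (hβP : β ∈ P)
    (hβ0 : 0 < R.ht β) (hz : 0 < R.ht (R.ρ z β)) : R.rank P z < R.rank P (z * t) := by
  have := ht.rank_add_ncard_le hβ hβP hβ0 hz (E := {β})
    (by simpa using ht.self_mem_inversions hβ hβP hβ0 hz)
    (by simpa [ht.apply_self hβ] using ⟨hβ0, hz⟩)
  rw [Set.ncard_singleton] at this
  omega

theorem pos_of_rank_lt (ht : R.IsReflectionAt t β) (hβ : β ∈ R.roots) (hβP : β ∈ P)
    (hβ0 : 0 < R.ht β) (h : R.rank P z < R.rank P (z * t)) : 0 < R.ht (R.ρ z β) := by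
  by_contra hz
  have hz' := ht_neg_of_not_pos (R.map_mem _ _ hβ) hz
  have := ht.rank_lt hβ hβP hβ0 (z := z * t)
    (by rw [ρ_mul, ht.apply_self hβ, map_neg, map_neg]; linarith)
  rw [mul_assoc, ht.mul_self hβ, mul_one] at this
  omega

/-- If reflecting changes the rank by at least two, some positive root is to blame. -/
theorem exists_root_of_rank (ht : R.IsReflectionAt t β) (hβ : β ∈ R.roots) (hβP : β ∈ P)
    (h : R.rank P z + 2 ≤ R.rank P (z * t)) :
    ∃ δ ∈ R.roots, δ ≠ β ∧ 0 < R.ht δ ∧ R.ht (R.ρ t δ) < 0 ∧ 0 < R.ht (R.ρ z δ) ∧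
      R.ht (R.ρ z (R.ρ t δ)) < 0 := by
  classical
  by_contra! hcon
  let F : V → V := fun δ => if 0 < R.ht (R.ρ t δ) then R.ρ t δ else δ
  have hF : ∀ δ ∈ R.inversions P (z * t) \ {β}, F δ ∈ R.inversions P z := by
    rintro δ ⟨⟨h1, h2, h3, h4⟩, h5⟩
    rw [ρ_mul] at h4
    by_cases h : 0 < R.ht (R.ρ t δ)
    · simp only [F, if_pos h]
      exact ⟨R.map_mem _ _ h1, ht.apply_mem hβP h2, h, h4⟩
    · simp only [F, if_neg h]
      refine ⟨h1, h2, h3, ht_neg_of_not_pos (R.map_mem _ _ h1) fun h6 => ?_⟩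
      have := hcon δ h1 h5 h3 (ht_neg_of_not_pos (R.map_mem _ _ h1) h) h6
      linarith
  have hinj : Set.InjOn F (R.inversions P (z * t) \ {β}) := by
    have key : ∀ δ ∈ R.inversions P (z * t), ∀ ε, 0 < R.ht (R.ρ t δ) →
        ¬ 0 < R.ht (R.ρ t ε) → R.ρ t δ ≠ ε := by
      rintro δ hδ ε h1 h2 rfl
      rw [ht.apply_apply hβ] at h2
      exact h2 hδ.2.2.1
    intro δ hδ ε hε h
    by_cases h1 : 0 < R.ht (R.ρ t δ) <;> by_cases h2 : 0 < R.ht (R.ρ t ε)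
    · simp only [F, if_pos h1, if_pos h2] at h
      rw [← ht.apply_apply hβ δ, h, ht.apply_apply hβ]
    · simp only [F, if_pos h1, if_neg h2] at h
      exact absurd h (key δ hδ.1 ε h1 h2)
    · simp only [F, if_neg h1, if_pos h2] at h
      exact absurd h.symm (key ε hε.1 δ h2 h1)
    · simpa only [F, if_neg h1, if_neg h2] using h
  have h1 : (R.inversions P (z * t) \ {β}).ncard ≤ R.rank P z :=
    Set.ncard_le_ncard_of_injOn F hF hinj finite_inversions
  have h2 := Set.ncard_le_ncard_sdiff_add_ncard (R.inversions P (z * t)) {β}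
  rw [Set.ncard_singleton] at h2
  unfold rank at h h1
  omega

/-- If the reflection in `a` permutes the other positive roots in `P`, then it changes the rank
by exactly one. -/
theorem rank_mul (ht : R.IsReflectionAt t α) (hα : α ∈ R.roots) (hαP : α ∈ P)
    (hα0 : 0 < R.ht α) (hperm : ∀ γ ∈ R.roots, γ ∈ P → 0 < R.ht γ → γ ≠ α → 0 < R.ht (R.ρ t γ))
    (hz : 0 < R.ht (R.ρ z α)) : R.rank P (z * t) = R.rank P z + 1 := by
  have hset : R.inversions P (z * t) = insert α (R.ρ t '' R.inversions P z) := by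
    ext γ
    simp only [Set.mem_insert_iff, Set.mem_image]
    constructor
    · rintro ⟨h1, h2, h3, h4⟩
      by_cases h : γ = α
      · exact Or.inl h
      · exact Or.inr ⟨R.ρ t γ, ⟨R.map_mem _ _ h1, ht.apply_mem hαP h2, hperm γ h1 h2 h3 h,
          by rwa [← ρ_mul]⟩, ht.apply_apply hα γ⟩
    · rintro (rfl | ⟨δ, ⟨h1, h2, h3, h4⟩, rfl⟩)
      · exact ht.self_mem_inversions hα hαP hα0 hz
      · refine ⟨R.map_mem _ _ h1, ht.apply_mem hαP h2, hperm δ h1 h2 h3 ?_, ?_⟩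
        · rintro rfl
          linarith
        · rwa [ρ_mul, ht.apply_apply hα]
  have hinj : Function.Injective (R.ρ t) := fun x y h => by
    rw [← ht.apply_apply hα x, h, ht.apply_apply hα]
  have hnot : α ∉ R.ρ t '' R.inversions P z := by
    rintro ⟨δ, ⟨-, -, h3, -⟩, h⟩
    have : δ = -α := by rw [← ht.apply_self hα, ← h, ht.apply_apply hα]
    rw [this, map_neg] at h3
    linarith
  unfold rank
  rw [hset, Set.ncard_insert_of_notMem hnot (finite_inversions.image _),
    Set.ncard_image_of_injective _ hinj]

end IsReflectionAt

/-! ### Rank two subsystems -/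

variable (R P) in
/-- `a` and `b`, with reflections `ra` and `rb`, are the two simple roots of the positive roots
in `P`. -/
structure IsSimplePair (a b : V) (ra rb : W) : Prop where
  left_mem : a ∈ R.roots
  right_mem : b ∈ R.roots
  left_mem_plane : a ∈ P
  right_mem_plane : b ∈ P
  left_pos : 0 < R.ht a
  right_pos : 0 < R.ht b
  ne : a ≠ b
  left_refl : R.IsReflectionAt ra a
  right_refl : R.IsReflectionAt rb b
  exists_coeff : ∀ γ ∈ R.roots, γ ∈ P → 0 < R.ht γ →
    ∃ c d : ℝ, 0 ≤ c ∧ 0 ≤ d ∧ γ = c • a + d • b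

theorem exists_isSimplePair (hrefl : ∀ α ∈ R.roots, ∃ t, R.IsReflectionAt t α)
    (hα : α ∈ R.roots) (hβ : β ∈ R.roots) (hα0 : 0 < R.ht α) (hβ0 : 0 < R.ht β) (hne : α ≠ β) :
    ∃ a b ra rb, R.IsSimplePair (Submodule.span ℝ {α, β}) a b ra rb := by
  set P := Submodule.span ℝ {α, β}
  have hαP : α ∈ P := Submodule.subset_span (by simp)
  have hβP : β ∈ P := Submodule.subset_span (by simp)
  set u := R.ht β • α - R.ht α • β
  have hg : ∀ γ : V, ∃ g : ℝ, γ ∈ P → γ = (R.ht γ / R.ht α) • α + g • u := by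
    intro γ
    by_cases h : γ ∈ P
    · obtain ⟨c, d, rfl⟩ := Submodule.mem_span_pair.mp h
      refine ⟨-d / R.ht α, fun _ => ?_⟩
      simp only [u, map_add, map_smul, smul_eq_mul]
      match_scalars <;> field_simp <;> ring
    · exact ⟨0, fun h' => absurd h' h⟩
  choose g hg using hg
  set S : Set V := {γ | γ ∈ R.roots ∧ γ ∈ P ∧ 0 < R.ht γ}
  have hS : S.Finite := R.finite_roots.subset fun _ h => h.1
  have hαS : α ∈ S := ⟨hα, hαP, hα0⟩
  have hβS : β ∈ S := ⟨hβ, hβP, hβ0⟩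
  let s : V → ℝ := fun γ => g γ / R.ht γ
  have hs : ∀ γ ∈ S, γ = (R.ht γ / R.ht α) • α + (R.ht γ * s γ) • u := by
    rintro γ ⟨-, h2, h3⟩
    rw [mul_div_cancel₀ _ h3.ne']
    exact hg γ h2
  obtain ⟨a, ha, hamin⟩ := Set.exists_min_image S s hS ⟨α, hαS⟩
  obtain ⟨b, hb, hbmax⟩ := Set.exists_max_image S s hS ⟨α, hαS⟩
  have hlt : s a < s b := by
    refine lt_of_le_of_ne (hamin b hb) fun heq => hne ?_
    have hsα : s α = s a := le_antisymm ((hbmax α hαS).trans heq.ge) (hamin α hαS)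
    have hsβ : s β = s a := le_antisymm ((hbmax β hβS).trans heq.ge) (hamin β hβS)
    have h1 := hs α hαS
    have h2 := hs β hβS
    refine eq_of_smul hα hβ hα0 hβ0 (c := R.ht α / R.ht β) ?_
    rw [hsα] at h1
    rw [hsβ] at h2
    have h3 : R.ht β • α = R.ht α • β := by
      conv_lhs => rw [h1]
      conv_rhs => rw [h2]
      match_scalars <;> field_simp
    rw [div_eq_inv_mul, ← smul_smul, ← h3, smul_smul, inv_mul_cancel₀ hβ0.ne', one_smul]
  obtain ⟨ra, hra⟩ := hrefl a ha.1
  obtain ⟨rb, hrb⟩ := hrefl b hb.1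
  refine ⟨a, b, ra, rb, ha.1, hb.1, ha.2.1, hb.2.1, ha.2.2, hb.2.2, ?_, hra, hrb, ?_⟩
  · rintro rfl
    exact lt_irrefl _ hlt
  · intro γ h1 h2 h3
    have hγ : γ ∈ S := ⟨h1, h2, h3⟩
    have hA := ha.2.2
    have hB := hb.2.2
    have hd : 0 < s b - s a := sub_pos.mpr hlt
    have hd1 : 0 ≤ s b - s γ := sub_nonneg.mpr (hbmax γ hγ)
    have hd2 : 0 ≤ s γ - s a := sub_nonneg.mpr (hamin γ hγ)
    set c := R.ht γ / R.ht a * ((s b - s γ) / (s b - s a)) with hc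
    set d := R.ht γ / R.ht b * ((s γ - s a) / (s b - s a)) with hd'
    refine ⟨c, d, by positivity, by positivity, ?_⟩
    have e1 : c * (R.ht a / R.ht α) + d * (R.ht b / R.ht α) = R.ht γ / R.ht α := by
      rw [hc, hd']; field_simp; ring
    have e2 : c * (R.ht a * s a) + d * (R.ht b * s b) = R.ht γ * s γ := by
      rw [hc, hd']; field_simp; ring
    calc γ = (R.ht γ / R.ht α) • α + (R.ht γ * s γ) • u := hs γ hγ
      _ = c • ((R.ht a / R.ht α) • α + (R.ht a * s a) • u) +
          d • ((R.ht b / R.ht α) • α + (R.ht b * s b) • u) := by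
        rw [← e1, ← e2]; module
      _ = c • a + d • b := by rw [← hs a ha, ← hs b hb]

namespace IsSimplePair

variable {a b : V} {ra rb : W}

theorem symm (h : R.IsSimplePair P a b ra rb) : R.IsSimplePair P b a rb ra where
  left_mem := h.right_mem
  right_mem := h.left_mem
  left_mem_plane := h.right_mem_plane
  right_mem_plane := h.left_mem_plane
  left_pos := h.right_pos
  right_pos := h.left_pos
  ne := h.ne.symm
  left_refl := h.right_refl
  right_refl := h.left_refl
  exists_coeff γ h1 h2 h3 := by
    obtain ⟨c, d, hc, hd, e⟩ := h.exists_coeff γ h1 h2 h3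
    exact ⟨d, c, hd, hc, by rw [e, add_comm]⟩

theorem refl_ne (h : R.IsSimplePair P a b ra rb) : ra ≠ rb := by
  rintro rfl
  have h1 := h.left_refl.apply_self h.left_mem
  rw [h.right_refl] at h1
  have h2 := coeffs_eq_zero h.left_mem h.right_mem h.left_pos h.right_pos h.ne
    (c := 2) (d := -R.form a b) (by rw [two_smul, neg_smul]; nth_rw 2 [← neg_neg a]; rw [← h1]; abel)
  linarith [h2.1]

/-- A simple reflection permutes the other positive roots of the plane. -/
theorem pos_of_ne (h : R.IsSimplePair P a b ra rb) (hγ : γ ∈ R.roots) (hγP : γ ∈ P)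
    (hγ0 : 0 < R.ht γ) (hne : γ ≠ a) : 0 < R.ht (R.ρ ra γ) := by
  by_contra hcon
  have hmem := R.map_mem ra γ hγ
  have hneg := ht_neg_of_not_pos hmem hcon
  obtain ⟨c, d, hc, hd, e⟩ := h.exists_coeff γ hγ hγP hγ0
  obtain ⟨c', d', hc', hd', e'⟩ := h.exists_coeff _ (R.neg_mem _ hmem)
    (P.neg_mem (h.left_refl.apply_mem h.left_mem_plane hγP)) (by rw [map_neg]; linarith)
  rw [h.left_refl] at e'
  have h1 := coeffs_eq_zero h.left_mem h.right_mem h.left_pos h.right_pos h.ne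
    (c := c + c' - R.form γ a) (d := d + d') (by
      have : c' • a + d' • b + (γ - R.form γ a • a) = 0 := by rw [← e']; abel
      nth_rw 1 [e] at this
      rw [← this]; module)
  have hd0 : d = 0 := by linarith [h1.2]
  rw [hd0, zero_smul, add_zero] at e
  exact hne (eq_of_smul hγ h.left_mem hγ0 h.left_pos e)

theorem rank_mul_left (h : R.IsSimplePair P a b ra rb) (hz : 0 < R.ht (R.ρ z a)) :
    R.rank P (z * ra) = R.rank P z + 1 :=
  h.left_refl.rank_mul h.left_mem h.left_mem_plane h.left_pos
    (fun _ h1 h2 h3 h4 => h.pos_of_ne h1 h2 h3 h4) hz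

theorem mul_left_neg (h : R.IsSimplePair P a b ra rb) :
    R.ht (R.ρ (z * ra) a) = -R.ht (R.ρ z a) := by
  rw [ρ_mul, h.left_refl.apply_self h.left_mem, map_neg, map_neg]

theorem rank_mul_left' (h : R.IsSimplePair P a b ra rb) (hz : ¬ 0 < R.ht (R.ρ z a)) :
    R.rank P (z * ra) + 1 = R.rank P z := by
  have hz' := ht_neg_of_not_pos (R.map_mem z a h.left_mem) hz
  have := h.rank_mul_left (z := z * ra) (by rw [h.mul_left_neg]; linarith)
  rw [mul_assoc, h.left_refl.mul_self h.left_mem, mul_one] at this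
  exact this.symm

/-- Every reflection of the plane lies in the group generated by the simple ones. -/
theorem mem_closure (h : R.IsSimplePair P a b ra rb) :
    ∀ γ ∈ R.roots, γ ∈ P → 0 < R.ht γ → ∀ t, R.IsReflectionAt t γ →
      t ∈ Subgroup.closure {ra, rb} := by
  by_contra! hcon
  set S : Set V := {γ | γ ∈ R.roots ∧ γ ∈ P ∧ 0 < R.ht γ ∧
    ∃ t, R.IsReflectionAt t γ ∧ t ∉ Subgroup.closure {ra, rb}}
  have hS : S.Finite := R.finite_roots.subset fun _ h => h.1
  obtain ⟨γ, ⟨h1, h2, h3, t, ht, hmem⟩, hmin⟩ := Set.exists_min_image S R.ht hS (by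
    obtain ⟨γ, h1, h2, h3, t, ht, hmem⟩ := hcon
    exact ⟨γ, h1, h2, h3, t, ht, hmem⟩)
  have key : ∀ {a b ra rb}, R.IsSimplePair P a b ra rb → ra ∈ Subgroup.closure {ra, rb} →
      t ∉ Subgroup.closure {ra, rb} → (∀ δ ∈ R.roots, δ ∈ P → 0 < R.ht δ → R.ht δ < R.ht γ →
        ∀ t, R.IsReflectionAt t δ → t ∈ Subgroup.closure {ra, rb}) → R.form γ a ≤ 0 := by
    intro a b ra rb h hra hmem hlt
    by_contra! hpos
    have hne : γ ≠ a := by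
      rintro rfl
      exact hmem (ht.unique h.left_refl ▸ hra)
    have h4 := hlt (R.ρ ra γ) (R.map_mem _ _ h1) (h.left_refl.apply_mem h.left_mem_plane h2)
      (h.pos_of_ne h1 h2 h3 hne) (by
        rw [h.left_refl, map_sub, map_smul, smul_eq_mul]
        have := mul_pos hpos h.left_pos
        linarith) _ (ht.conj ra)
    apply hmem
    have h5 := Subgroup.mul_mem _ (Subgroup.mul_mem _ (Subgroup.inv_mem _ hra) h4) hra
    simpa [mul_assoc] using h5
  have hlt : ∀ δ ∈ R.roots, δ ∈ P → 0 < R.ht δ → R.ht δ < R.ht γ →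
        ∀ t, R.IsReflectionAt t δ → t ∈ Subgroup.closure {ra, rb} := by
    intro δ g1 g2 g3 g4 t' g5
    by_contra g6
    exact absurd (hmin δ ⟨g1, g2, g3, t', g5, g6⟩) (not_le.mpr g4)
  have ka := key h (Subgroup.subset_closure (by simp)) hmem hlt
  have kb := key h.symm (Subgroup.subset_closure (by simp)) (by rwa [Set.pair_comm])
    (by simpa only [Set.pair_comm] using hlt)
  obtain ⟨c, d, hc, hd, e⟩ := h.exists_coeff γ h1 h2 h3
  have h6 := R.form_self γ h1
  nth_rw 2 [e] at h6
  rw [map_add, map_smul, map_smul, smul_eq_mul, smul_eq_mul] at h6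
  nlinarith

theorem apply_mem_plane (h : R.IsSimplePair P a b ra rb) {d : W}
    (hd : d ∈ Subgroup.closure {ra, rb}) : ∀ v ∈ P, R.ρ d v ∈ P := by
  induction hd using Subgroup.closure_induction_left with
  | one => intro v hv; simpa using hv
  | mul_left x hx y _ ih =>
    intro v hv
    rw [ρ_mul]
    rcases hx with rfl | rfl
    · exact h.left_refl.apply_mem h.left_mem_plane (ih v hv)
    · exact h.right_refl.apply_mem h.right_mem_plane (ih v hv)
  | inv_mul_cancel x hx y _ ih =>
    intro v hv
    rw [ρ_mul]
    rcases hx with rfl | rfl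
    · rw [h.left_refl.inv h.left_mem]
      exact h.left_refl.apply_mem h.left_mem_plane (ih v hv)
    · rw [h.right_refl.inv h.right_mem]
      exact h.right_refl.apply_mem h.right_mem_plane (ih v hv)

theorem left_mul_zpow (h : R.IsSimplePair P a b ra rb) (k : ℤ) :
    ra * (ra * rb) ^ k = (ra * rb) ^ (-k) * ra := by
  have h1 : ra * (ra * rb) * ra⁻¹ = (ra * rb)⁻¹ := by
    rw [mul_inv_rev, h.left_refl.inv h.left_mem, h.right_refl.inv h.right_mem, ← mul_assoc,
      h.left_refl.mul_self h.left_mem, one_mul]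
  have h2 := conj_zpow (a := ra) (b := ra * rb) (i := k)
  rw [h1, inv_zpow', eq_mul_inv_iff_mul_eq] at h2
  exact h2.symm

theorem eq_zpow_or (h : R.IsSimplePair P a b ra rb) {d : W}
    (hd : d ∈ Subgroup.closure {ra, rb}) :
    ∃ k : ℤ, d = (ra * rb) ^ k ∨ d = (ra * rb) ^ k * ra := by
  have hrb : rb = (ra * rb) ^ (-1 : ℤ) * ra := by
    rw [zpow_neg_one, mul_inv_rev, h.left_refl.inv h.left_mem, h.right_refl.inv h.right_mem,
      mul_assoc, h.left_refl.mul_self h.left_mem, mul_one]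
  have hleft : ∀ d : W, (∃ k : ℤ, d = (ra * rb) ^ k ∨ d = (ra * rb) ^ k * ra) →
      ∃ k : ℤ, ra * d = (ra * rb) ^ k ∨ ra * d = (ra * rb) ^ k * ra := by
    rintro d ⟨k, rfl | rfl⟩
    · exact ⟨-k, Or.inr (h.left_mul_zpow k)⟩
    · refine ⟨-k, Or.inl ?_⟩
      rw [← mul_assoc, h.left_mul_zpow, mul_assoc, h.left_refl.mul_self h.left_mem, mul_one]
  have hright : ∀ d : W, (∃ k : ℤ, d = (ra * rb) ^ k ∨ d = (ra * rb) ^ k * ra) →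
      ∃ k : ℤ, rb * d = (ra * rb) ^ k ∨ rb * d = (ra * rb) ^ k * ra := by
    intro d hd
    have : rb * d = (ra * rb) ^ (-1 : ℤ) * (ra * d) := by
      nth_rw 1 [hrb]; rw [mul_assoc]
    obtain ⟨k, hk | hk⟩ := hleft d hd
    · exact ⟨-1 + k, Or.inl (by rw [this, hk, zpow_add])⟩
    · exact ⟨-1 + k, Or.inr (by rw [this, hk, zpow_add, mul_assoc])⟩
  induction hd using Subgroup.closure_induction_left with
  | one => exact ⟨0, Or.inl (zpow_zero _).symm⟩
  | mul_left x hx y _ ih =>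
    rcases hx with rfl | rfl
    · exact hleft y ih
    · exact hright y ih
  | inv_mul_cancel x hx y _ ih =>
    rcases hx with rfl | rfl
    · rw [h.left_refl.inv h.left_mem]
      exact hleft y ih
    · rw [h.right_refl.inv h.right_mem]
      exact hright y ih

/-- Odd elements of the dihedral group of a plane are reflections of that plane. -/
theorem exists_root_of_sign (h : R.IsSimplePair P a b ra rb) {d : W}
    (hd : d ∈ Subgroup.closure {ra, rb}) (hs : R.sign d = -1) :
    ∃ γ ∈ R.roots, γ ∈ P ∧ 0 < R.ht γ ∧ R.IsReflectionAt d γ := by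
  suffices hsuff : ∃ γ ∈ R.roots, γ ∈ P ∧ R.IsReflectionAt d γ by
    obtain ⟨γ, h1, h2, h3⟩ := hsuff
    by_cases h4 : 0 < R.ht γ
    · exact ⟨γ, h1, h2, h4, h3⟩
    · refine ⟨-γ, R.neg_mem _ h1, P.neg_mem h2, ?_, h3.neg⟩
      rw [map_neg]
      linarith [ht_neg_of_not_pos h1 h4]
  have hra : ra ∈ Subgroup.closure {ra, rb} := Subgroup.subset_closure (by simp)
  have hrb : rb ∈ Subgroup.closure {ra, rb} := Subgroup.subset_closure (by simp)
  have hc : ∀ j : ℤ, (ra * rb) ^ j ∈ Subgroup.closure {ra, rb} := fun j =>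
    Subgroup.zpow_mem _ (Subgroup.mul_mem _ hra hrb) j
  have hconj : ∀ j k : ℤ, (ra * rb) ^ j * ((ra * rb) ^ k * ra) * ((ra * rb) ^ j)⁻¹ =
      (ra * rb) ^ (j + k + j) * ra := by
    intro j k
    rw [← zpow_neg, mul_assoc, mul_assoc, h.left_mul_zpow, neg_neg, zpow_add, zpow_add]
    simp only [mul_assoc]
  obtain ⟨k, rfl | rfl⟩ := h.eq_zpow_or hd
  · rw [map_zpow, map_mul, R.sign_reflection _ _ h.left_mem h.left_refl,
      R.sign_reflection _ _ h.right_mem h.right_refl] at hs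
    simp at hs
  · obtain ⟨j, rfl | rfl⟩ := Int.even_or_odd' k
    · refine ⟨R.ρ ((ra * rb) ^ j) a, R.map_mem _ _ h.left_mem,
        h.apply_mem_plane (hc j) _ h.left_mem_plane, ?_⟩
      have := h.left_refl.conj ((ra * rb) ^ j)
      have e := hconj j 0
      rw [zpow_zero, one_mul] at e
      rw [e] at this
      convert this using 3
      ring
    · refine ⟨R.ρ ((ra * rb) ^ j) (R.ρ ra b), R.map_mem _ _ (R.map_mem _ _ h.right_mem),
        h.apply_mem_plane (hc j) _ (h.apply_mem_plane hra _ h.right_mem_plane), ?_⟩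
      have := (h.right_refl.conj ra).conj ((ra * rb) ^ j)
      have e := hconj j 1
      rw [zpow_one] at e
      rw [h.left_refl.inv h.left_mem, e] at this
      convert this using 3
      ring

theorem neg_one_pow_rank (h : R.IsSimplePair P a b ra rb) {d : W}
    (hd : d ∈ Subgroup.closure {ra, rb}) :
    ∀ z, (-1 : ℤˣ) ^ R.rank P (z * d) = R.sign d * (-1) ^ R.rank P z := by
  have key : ∀ {a b ra rb}, R.IsSimplePair P a b ra rb →
      ∀ z, (-1 : ℤˣ) ^ R.rank P (z * ra) = R.sign ra * (-1) ^ R.rank P z := by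
    intro a b ra rb h z
    rw [R.sign_reflection _ _ h.left_mem h.left_refl]
    by_cases hz : 0 < R.ht (R.ρ z a)
    · rw [h.rank_mul_left hz, pow_succ, mul_comm]
    · rw [← h.rank_mul_left' hz, pow_succ]
      simp
  induction hd using Subgroup.closure_induction with
  | mem x hx =>
    rcases hx with rfl | rfl
    · exact key h
    · exact key h.symm
  | one => intro z; simp
  | mul x y _ _ ihx ihy =>
    intro z
    rw [← mul_assoc, ihy, ihx, map_mul, ← mul_assoc, mul_comm (R.sign y)]
  | inv x _ ih =>
    intro z
    have := ih (z * x⁻¹)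
    rw [inv_mul_cancel_right] at this
    rw [this, map_inv, inv_mul_cancel_left]

theorem rank_eq_zero (h : R.IsSimplePair P a b ra rb) (ha : 0 < R.ht (R.ρ z a))
    (hb : 0 < R.ht (R.ρ z b)) : R.rank P z = 0 := by
  have : R.inversions P z = ∅ := by
    rw [Set.eq_empty_iff_forall_notMem]
    rintro γ ⟨h1, h2, h3, h4⟩
    obtain ⟨c, d, hc, hd, rfl⟩ := h.exists_coeff γ h1 h2 h3
    simp only [map_add, map_smul, smul_eq_mul] at h4
    have := mul_nonneg hc ha.le
    have := mul_nonneg hd hb.le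
    linarith
  rw [rank, this, Set.ncard_empty]

theorem rank_eq_top (h : R.IsSimplePair P a b ra rb) (ha : R.ht (R.ρ z a) < 0)
    (hb : R.ht (R.ρ z b) < 0) (y : W) : R.rank P y ≤ R.rank P z := by
  refine Set.ncard_le_ncard ?_ finite_inversions
  rintro γ ⟨h1, h2, h3, -⟩
  refine ⟨h1, h2, h3, ht_neg_of_not_pos (R.map_mem _ _ h1) (not_lt.mpr ?_)⟩
  obtain ⟨c, d, hc, hd, rfl⟩ := h.exists_coeff γ h1 h2 h3
  simp only [map_add, map_smul, smul_eq_mul]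
  have := mul_nonneg hc (neg_nonneg.mpr ha.le)
  have := mul_nonneg hd (neg_nonneg.mpr hb.le)
  linarith

theorem exists_rank_eq_zero (h : R.IsSimplePair P a b ra rb) (x : W) :
    ∃ z, x⁻¹ * z ∈ Subgroup.closure {ra, rb} ∧ 0 < R.ht (R.ρ z a) ∧ 0 < R.ht (R.ρ z b) := by
  induction hn : R.rank P x using Nat.strong_induction_on generalizing x with
  | _ n ih =>
    by_cases ha : 0 < R.ht (R.ρ x a)
    · by_cases hb : 0 < R.ht (R.ρ x b)
      · exact ⟨x, by simp, ha, hb⟩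
      · have := h.symm.rank_mul_left' hb
        obtain ⟨z, hz, h1⟩ := ih _ (by omega) (x * rb) rfl
        refine ⟨z, ?_, h1⟩
        have := Subgroup.mul_mem _
          (Subgroup.subset_closure (by simp : rb ∈ ({ra, rb} : Set W))) hz
        simpa [mul_assoc] using this
    · have := h.rank_mul_left' ha
      obtain ⟨z, hz, h1⟩ := ih _ (by omega) (x * ra) rfl
      refine ⟨z, ?_, h1⟩
      have := Subgroup.mul_mem _
        (Subgroup.subset_closure (by simp : ra ∈ ({ra, rb} : Set W))) hz
      simpa [mul_assoc] using this

/-- A coset of the dihedral group has at least two elements of each intermediate rank. -/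
theorem exists_pair_rank (h : R.IsSimplePair P a b ra rb) (x y : W) (j : ℕ)
    (hj : j + 1 < R.rank P y) :
    ∃ p q, p ≠ q ∧ x⁻¹ * p ∈ Subgroup.closure {ra, rb} ∧ x⁻¹ * q ∈ Subgroup.closure {ra, rb} ∧
      R.rank P p = j + 1 ∧ R.rank P q = j + 1 := by
  have hra : ra ∈ Subgroup.closure {ra, rb} := Subgroup.subset_closure (by simp)
  have hrb : rb ∈ Subgroup.closure {ra, rb} := Subgroup.subset_closure (by simp)
  have hmem : ∀ {p r : W}, x⁻¹ * p ∈ Subgroup.closure {ra, rb} →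
      r ∈ Subgroup.closure {ra, rb} → x⁻¹ * (p * r) ∈ Subgroup.closure {ra, rb} := by
    intro p r h1 h2
    rw [← mul_assoc]
    exact Subgroup.mul_mem _ h1 h2
  induction j with
  | zero =>
    obtain ⟨z, hz, ha, hb⟩ := h.exists_rank_eq_zero x
    have h0 := h.rank_eq_zero ha hb
    refine ⟨z * ra, z * rb, fun e => h.refl_ne (mul_left_cancel e), hmem hz hra, hmem hz hrb, ?_, ?_⟩
    · rw [h.rank_mul_left ha, h0]
    · rw [h.symm.rank_mul_left hb, h0]
  | succ j ih =>
    obtain ⟨p, q, hpq, hp, hq, hpr, hqr⟩ := ih (by omega)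
    have hup : ∀ {p}, R.rank P p = j + 1 → ¬ 0 < R.ht (R.ρ p a) → 0 < R.ht (R.ρ p b) := by
      intro p hp hpa
      by_contra hpb
      have := h.rank_eq_top (ht_neg_of_not_pos (R.map_mem _ _ h.left_mem) hpa)
        (ht_neg_of_not_pos (R.map_mem _ _ h.right_mem) hpb) y
      omega
    have hne : ∀ {p q}, R.rank P p = j + 1 → 0 < R.ht (R.ρ p a) → 0 < R.ht (R.ρ q b) →
        p * ra ≠ q * rb := by
      intro p q hp hpa hqb e
      have h1 := h.mul_left_neg (z := p)
      have h2 := h.symm.mul_left_neg (z := q)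
      rw [← e] at h2
      have h3 := h.rank_eq_top (z := p * ra) (by linarith) (by linarith) y
      rw [h.rank_mul_left hpa] at h3
      omega
    by_cases hpa : 0 < R.ht (R.ρ p a) <;> by_cases hqa : 0 < R.ht (R.ρ q a)
    · exact ⟨p * ra, q * ra, fun e => hpq (mul_right_cancel e), hmem hp hra, hmem hq hra,
        by rw [h.rank_mul_left hpa, hpr], by rw [h.rank_mul_left hqa, hqr]⟩
    · exact ⟨p * ra, q * rb, hne hpr hpa (hup hqr hqa), hmem hp hra, hmem hq hrb,
        by rw [h.rank_mul_left hpa, hpr], by rw [h.symm.rank_mul_left (hup hqr hqa), hqr]⟩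
    · exact ⟨p * rb, q * ra, (hne hqr hqa (hup hpr hpa)).symm, hmem hp hrb, hmem hq hra,
        by rw [h.symm.rank_mul_left (hup hpr hpa), hpr], by rw [h.rank_mul_left hqa, hqr]⟩
    · exact ⟨p * rb, q * rb, fun e => hpq (mul_right_cancel e), hmem hp hrb, hmem hq hrb,
        by rw [h.symm.rank_mul_left (hup hpr hpa), hpr],
        by rw [h.symm.rank_mul_left (hup hqr hqa), hqr]⟩

/-- Within a coset of the dihedral group, elements whose ranks differ by an odd number are joined
by a reflection, and the direction of the edge is the same for the full rank. -/
theorem edge_of_rank_lt (h : R.IsSimplePair P a b ra rb) {p q : W}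
    (hpq : p⁻¹ * q ∈ Subgroup.closure {ra, rb}) (hlt : R.rank P p < R.rank P q)
    (hodd : Odd (R.rank P p + R.rank P q)) :
    (∃ γ ∈ R.roots, R.IsReflectionAt (p⁻¹ * q) γ) ∧ R.rank ⊤ p < R.rank ⊤ q := by
  have hsign : R.sign (p⁻¹ * q) = -1 := by
    have h1 := h.neg_one_pow_rank hpq p
    rw [mul_inv_cancel_left] at h1
    have h2 : R.sign (p⁻¹ * q) = (-1) ^ (R.rank P p + R.rank P q) := by
      rw [pow_add, h1, mul_left_comm, ← pow_add, Even.neg_one_pow ⟨_, rfl⟩, mul_one]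
    rw [h2, hodd.neg_one_pow]
  obtain ⟨γ, h1, h2, h3, h4⟩ := h.exists_root_of_sign hpq hsign
  refine ⟨⟨γ, h1, h4⟩, ?_⟩
  have h5 : 0 < R.ht (R.ρ p γ) := h4.pos_of_rank_lt h1 h2 h3 (by rwa [mul_inv_cancel_left])
  have h6 := h4.rank_lt h1 (Submodule.mem_top) h3 h5
  rwa [mul_inv_cancel_left] at h6

end IsSimplePair

/-- An edge along which the rank jumps by at least two spans a diamond-like subgraph: two rank
increasing edges out of `x`, all joined to two further vertices below `y`. -/
theorem exists_crossing (hrefl : ∀ α ∈ R.roots, ∃ t, R.IsReflectionAt t α) {x y : W}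
    (hβ : β ∈ R.roots) (hβ0 : 0 < R.ht β) (ht : R.IsReflectionAt (x⁻¹ * y) β)
    (hxy : R.rank ⊤ x + 2 ≤ R.rank ⊤ y) :
    ∃ p : Fin 2 → W, ∃ q : Fin 2 → W, p 0 ≠ p 1 ∧ q 0 ≠ q 1 ∧ ∀ i,
      ((∃ γ ∈ R.roots, R.IsReflectionAt (x⁻¹ * p i) γ) ∧ R.rank ⊤ x < R.rank ⊤ (p i)) ∧
      ((∃ γ ∈ R.roots, R.IsReflectionAt ((q i)⁻¹ * y) γ) ∧ R.rank ⊤ (q i) < R.rank ⊤ y) ∧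
      ∀ j, (∃ γ ∈ R.roots, R.IsReflectionAt ((p i)⁻¹ * q j) γ) ∧
        R.rank ⊤ (p i) < R.rank ⊤ (q j) := by
  obtain ⟨t, rfl⟩ : ∃ t, y = x * t := ⟨x⁻¹ * y, by group⟩
  rw [inv_mul_cancel_left] at ht
  obtain ⟨δ, hδ, hne, hδ0, h1, h2, h3⟩ := ht.exists_root_of_rank hβ (P := ⊤) trivial hxy
  have hx : 0 < R.ht (R.ρ x β) := ht.pos_of_rank_lt hβ (P := ⊤) trivial hβ0 (by omega)
  obtain ⟨a, b, ra, rb, hab⟩ := exists_isSimplePair hrefl hβ hδ hβ0 hδ0 hne.symm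
  set P := Submodule.span ℝ {β, δ}
  have hβP : β ∈ P := Submodule.subset_span (by simp)
  have hδP : δ ∈ P := Submodule.subset_span (by simp)
  have htd := hab.mem_closure β hβ hβP hβ0 t ht
  have e1 : β ≠ -R.ρ t δ := by
    intro h
    apply hne
    rw [← ht.apply_apply hβ δ, ← neg_neg (R.ρ t δ), ← h, map_neg, ht.apply_self hβ, neg_neg]
  have e2 : δ ≠ -R.ρ t δ := by
    intro h
    refine hne (eq_of_smul hδ hβ hδ0 hβ0 (c := R.form δ β / 2) ?_)
    rw [ht] at h
    have : (2 : ℝ) • δ = R.form δ β • β := by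
      rw [two_smul]; nth_rw 1 [h]; abel
    rw [div_eq_inv_mul, mul_smul, ← this, smul_smul]
    norm_num
  have hcard := ht.rank_add_ncard_le hβ hβP hβ0 hx (E := {β, δ, -R.ρ t δ}) (by
      rintro γ (rfl | rfl | rfl)
      · exact ht.self_mem_inversions hβ hβP hβ0 hx
      · exact ⟨hδ, hδP, hδ0, by rwa [ρ_mul]⟩
      · refine ⟨R.neg_mem _ (R.map_mem _ _ hδ), P.neg_mem (ht.apply_mem hβP hδP), ?_, ?_⟩
        · rw [map_neg]; linarith
        · rw [ρ_mul, map_neg, ht.apply_apply hβ, map_neg, map_neg]; linarith) (by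
      rintro γ (rfl | rfl | rfl)
      · rw [ht.apply_self hβ, map_neg]; exact ⟨by linarith, hx⟩
      · exact ⟨h1, h2⟩
      · rw [map_neg, ht.apply_apply hβ, map_neg, map_neg, map_neg]
        exact ⟨by linarith, by linarith⟩)
  rw [Set.ncard_eq_three.mpr ⟨β, δ, _, hne.symm, e1, e2, rfl⟩] at hcard
  obtain ⟨p₀, p₁, hp, hp₀, hp₁, rp₀, rp₁⟩ := hab.exists_pair_rank x (x * t) (R.rank P x) (by omega)
  obtain ⟨q₀, q₁, hq, hq₀, hq₁, rq₀, rq₁⟩ :=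
    hab.exists_pair_rank x (x * t) (R.rank P x + 1) (by omega)
  have hodd : Odd (R.rank P x + R.rank P (x * t)) := by
    have h := hab.neg_one_pow_rank htd x
    rw [R.sign_reflection t β hβ ht] at h
    by_contra hcon
    rw [Nat.not_odd_iff_even, Nat.even_add] at hcon
    rcases Nat.even_or_odd (R.rank P x) with h' | h'
    · rw [h'.neg_one_pow, (hcon.mp h').neg_one_pow] at h
      exact absurd h (by decide)
    · have h'' : Odd (R.rank P (x * t)) := by
        rw [← Nat.not_even_iff_odd] at h' ⊢
        exact fun h => h' (hcon.mpr h)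
      rw [h'.neg_one_pow, h''.neg_one_pow] at h
      exact absurd h (by decide)
  have hmem : ∀ {p q : W}, x⁻¹ * p ∈ Subgroup.closure {ra, rb} →
      x⁻¹ * q ∈ Subgroup.closure {ra, rb} → p⁻¹ * q ∈ Subgroup.closure {ra, rb} := by
    intro p q h h'
    have := mul_mem (inv_mem h) h'
    rwa [show (x⁻¹ * p)⁻¹ * (x⁻¹ * q) = p⁻¹ * q by group] at this
  have hxx : x⁻¹ * x ∈ Subgroup.closure {ra, rb} := by simp
  have hxt : x⁻¹ * (x * t) ∈ Subgroup.closure {ra, rb} := by rwa [inv_mul_cancel_left]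
  have hpm : ∀ i, x⁻¹ * ![p₀, p₁] i ∈ Subgroup.closure {ra, rb} ∧
      R.rank P (![p₀, p₁] i) = R.rank P x + 1 := by
    intro i; fin_cases i
    exacts [⟨hp₀, rp₀⟩, ⟨hp₁, rp₁⟩]
  have hqm : ∀ i, x⁻¹ * ![q₀, q₁] i ∈ Subgroup.closure {ra, rb} ∧
      R.rank P (![q₀, q₁] i) = R.rank P x + 1 + 1 := by
    intro i; fin_cases i
    exacts [⟨hq₀, rq₀⟩, ⟨hq₁, rq₁⟩]
  refine ⟨![p₀, p₁], ![q₀, q₁], hp, hq, fun i => ⟨?_, ?_, fun j => ?_⟩⟩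
  · exact hab.edge_of_rank_lt (hpm i).1 (by have := (hpm i).2; omega)
      (by rw [(hpm i).2]; exact ⟨R.rank P x, by ring⟩)
  · refine hab.edge_of_rank_lt (hmem (hqm i).1 hxt) (by have := (hqm i).2; omega) ?_
    rw [(hqm i).2, show R.rank P x + 1 + 1 + R.rank P (x * t) =
      R.rank P x + R.rank P (x * t) + 2 by ring]
    exact hodd.add_even even_two
  · refine hab.edge_of_rank_lt (hmem (hpm i).1 (hqm j).1) ?_ ?_
    · rw [(hpm i).2, (hqm j).2]; omega
    · rw [(hpm i).2, (hqm j).2]; exact ⟨R.rank P x + 1, by ring⟩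

/-- Two reflections with the same product as two reflections in `P` are themselves in `P`. -/
theorem mem_of_mul_eq {ra rb rc rd : W} {a b c d : V} (ha : R.IsReflectionAt ra a)
    (hb : R.IsReflectionAt rb b) (hc : R.IsReflectionAt rc c) (hd : R.IsReflectionAt rd d)
    (haP : a ∈ P) (hbP : b ∈ P) (hcR : c ∈ R.roots) (hdR : d ∈ R.roots)
    (h : ra * rb = rc * rd) (hne : rc ≠ rd) : c ∈ P ∧ d ∈ P := by
  set k := R.form c d with hk
  have hk' : R.form d c = k := R.form_symm _ _
  have hcc := R.form_self c hcR
  have hdd := R.form_self d hdR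
  have hmem : ∀ v, -(R.form v d) • d + (R.form v d * k - R.form v c) • c ∈ P := by
    intro v
    have h1 : R.ρ (ra * rb) v - v ∈ P := by
      have : R.ρ (ra * rb) v - v = -(R.form (R.ρ rb v) a • a + R.form v b • b) := by
        rw [ρ_mul, ha, hb]; abel
      rw [this]
      exact P.neg_mem (P.add_mem (P.smul_mem _ haP) (P.smul_mem _ hbP))
    rw [h, ρ_mul, hd, hc] at h1
    simp only [map_sub, map_smul, LinearMap.sub_apply, LinearMap.smul_apply, smul_eq_mul, hk'] at h1
    convert h1 using 1
    module
  have hk4 : 4 - k ^ 2 ≠ 0 := by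
    intro hk4
    set u := c - (k / 2) • d with hu
    have hud : R.form u d = 0 := by
      simp only [hu, map_sub, map_smul, LinearMap.sub_apply, LinearMap.smul_apply, smul_eq_mul, hdd]
      rw [← hk]; ring
    have huc : R.form u c = 0 := by
      simp only [hu, map_sub, map_smul, LinearMap.sub_apply, LinearMap.smul_apply, smul_eq_mul, hcc,
        hk']
      linarith
    have hcu : c = u + (k / 2) • d := by rw [hu]; abel
    have h1 : R.ρ (rc * rd) u = u := by
      rw [ρ_mul, hd, hud, zero_smul, sub_zero, hc, huc, zero_smul, sub_zero]
    have h2 : R.ρ (rc * rd) d = d + k • u := by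
      rw [ρ_mul, hd.apply_self hdR, map_neg, hc, hk']
      have : (k * (k / 2)) • d = (2 : ℝ) • d := by congr 1; linarith
      have h3 : k • c = k • u + (2 : ℝ) • d := by rw [← this, hu]; module
      rw [neg_sub, h3]
      module
    have hiter : ∀ n : ℕ, d + (n * k : ℝ) • u ∈ R.roots := by
      intro n
      induction n with
      | zero => simpa using hdR
      | succ n ih =>
        have := R.map_mem (rc * rd) _ ih
        rw [map_add, map_smul, h1, h2] at this
        convert this using 1
        push_cast
        module
    have hu0 : u = 0 := by
      by_contra hu0
      have hk0 : k ≠ 0 := by rintro h0; rw [h0] at hk4; norm_num at hk4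
      refine Set.infinite_of_injective_forall_mem (f := fun n : ℕ => d + (n * k : ℝ) • u) ?_ hiter
        R.finite_roots
      intro m n hmn
      have := smul_left_injective ℝ hu0 (add_left_cancel hmn)
      exact_mod_cast mul_right_cancel₀ hk0 this
    rw [hu0, zero_add] at hcu
    apply hne
    have hk2 : (k / 2) * (k / 2) = 1 := by linarith
    refine R.ext_ρ fun v => ?_
    rw [hc, hd, hcu, map_smul, smul_eq_mul, smul_smul, mul_right_comm, hk2, one_mul]
  have hcP : c ∈ P := by
    have h1 := hmem ((2 : ℝ) • c - k • d)
    simp only [map_sub, map_smul, LinearMap.sub_apply, LinearMap.smul_apply, smul_eq_mul, hcc, hdd,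
      hk', ← hk] at h1
    rw [show 2 * k - k * 2 = 0 by ring, neg_zero, zero_smul, zero_add,
      show 0 * k - (2 * 2 - k * k) = -(4 - k ^ 2) by ring] at h1
    exact (P.smul_mem_iff (neg_ne_zero.mpr hk4)).mp h1
  refine ⟨hcP, ?_⟩
  have h1 := hmem d
  rw [hdd, P.add_mem_iff_left (P.smul_mem _ hcP)] at h1
  exact (P.smul_mem_iff (by norm_num)).mp h1

/-- Two crossing pairs of paths of length three between `x` and `y` in the Bruhat graph force an
edge. -/
theorem exists_root_of_crossing (hrefl : ∀ α ∈ R.roots, ∃ t, R.IsReflectionAt t α) {x y : W}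
    {p q : Fin 2 → W} (hp : p 0 ≠ p 1) (hq : q 0 ≠ q 1)
    (hxp : ∀ i, ∃ γ ∈ R.roots, R.IsReflectionAt (x⁻¹ * p i) γ)
    (hpq : ∀ i j, ∃ γ ∈ R.roots, R.IsReflectionAt ((p i)⁻¹ * q j) γ)
    (hqy : ∀ j, ∃ γ ∈ R.roots, R.IsReflectionAt ((q j)⁻¹ * y) γ) :
    ∃ γ ∈ R.roots, R.IsReflectionAt (x⁻¹ * y) γ := by
  have hxp' : ∀ i, ∃ γ, γ ∈ R.roots ∧ 0 < R.ht γ ∧ R.IsReflectionAt (x⁻¹ * p i) γ := by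
    intro i
    obtain ⟨γ, h1, h2⟩ := hxp i
    by_cases h3 : 0 < R.ht γ
    · exact ⟨γ, h1, h3, h2⟩
    · have := ht_neg_of_not_pos h1 h3
      exact ⟨-γ, R.neg_mem _ h1, by rw [map_neg]; linarith, h2.neg⟩
  choose a haR ha0 ha using hxp'
  choose d hdR hd using hpq
  choose c hcR hc using hqy
  have hane : a 0 ≠ a 1 := by
    intro h
    have h1 := ha 1
    rw [← h] at h1
    exact hp (mul_left_cancel ((ha 0).unique h1))
  obtain ⟨e, f, re, rf, hef⟩ := exists_isSimplePair hrefl (haR 0) (haR 1) (ha0 0) (ha0 1) hane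
  set P := Submodule.span ℝ {a 0, a 1}
  have h0P : a 0 ∈ P := Submodule.subset_span (by simp)
  have h1P : a 1 ∈ P := Submodule.subset_span (by simp)
  have hdP : ∀ j, d 0 j ∈ P := by
    intro j
    refine (mem_of_mul_eq (ha 1) (ha 0) (hd 1 j) (hd 0 j) h1P h0P (hdR 1 j) (hdR 0 j) ?_ ?_).2
    · rw [← (ha 1).inv (haR 1), ← (hd 0 j).inv (hdR 0 j)]; group
    · intro h
      exact hp (inv_injective (mul_right_cancel h)).symm
  have hcP : c 0 ∈ P := by
    refine (mem_of_mul_eq (hd 0 0) (hd 0 1) (hc 0) (hc 1) (hdP 0) (hdP 1) (hcR 0) (hcR 1) ?_ ?_).1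
    · rw [← (hd 0 0).inv (hdR 0 0), ← (hc 1).inv (hcR 1)]; group
    · intro h
      exact hq (inv_injective (mul_right_cancel h))
  have hcl : ∀ {t γ}, γ ∈ R.roots → γ ∈ P → R.IsReflectionAt t γ →
      t ∈ Subgroup.closure {re, rf} := by
    intro t γ h1 h2 h3
    by_cases h4 : 0 < R.ht γ
    · exact hef.mem_closure γ h1 h2 h4 t h3
    · have := ht_neg_of_not_pos h1 h4
      exact hef.mem_closure (-γ) (R.neg_mem _ h1) (P.neg_mem h2) (by rw [map_neg]; linarith) t h3.neg
  have hprod : x⁻¹ * y = (x⁻¹ * p 0) * ((p 0)⁻¹ * q 0) * ((q 0)⁻¹ * y) := by group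
  obtain ⟨γ, h1, -, -, h2⟩ := hef.exists_root_of_sign (d := x⁻¹ * y)
    (by
      rw [hprod]
      exact mul_mem (mul_mem (hcl (haR 0) h0P (ha 0)) (hcl (hdR 0 0) (hdP 0) (hd 0 0)))
        (hcl (hcR 0) hcP (hc 0)))
    (by
      rw [hprod, map_mul, map_mul, R.sign_reflection _ _ (haR 0) (ha 0),
        R.sign_reflection _ _ (hdR 0 0) (hd 0 0), R.sign_reflection _ _ (hcR 0) (hc 0)]
      decide)
  exact ⟨γ, h1, h2⟩

end RootRep

/-! ### The geometric representation of a Weyl group -/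

namespace Geometric

/-- The absolute value of the form at two distinct simple roots whose reflections have a product of
order `m`; the value at `m = 1` makes the simple roots have norm two. -/
noncomputable def bond : ℕ → ℝ
  | 1 => -2
  | 2 => 0
  | 3 => 1
  | 4 => √2
  | _ => √3

/-- The canonical bilinear form of a Coxeter matrix with finite crystallographic entries. -/
noncomputable def form (M : CoxeterMatrix B) : (B →₀ ℝ) →ₗ[ℝ] (B →₀ ℝ) →ₗ[ℝ] ℝ :=
  Finsupp.linearCombination ℝ fun i => Finsupp.linearCombination ℝ fun j => -bond (M i j)

/-- The simple root at `i`. -/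
noncomputable abbrev simpleRoot (i : B) : B →₀ ℝ := Finsupp.single i 1

theorem form_simple (i j : B) : form M (simpleRoot i) (simpleRoot j) = -bond (M i j) := by
  simp [form]

theorem form_simple_self (i : B) : form M (simpleRoot i) (simpleRoot i) = 2 := by
  simp [form_simple, bond]

theorem form_symm (x y : B →₀ ℝ) : form M x y = form M y x := by
  suffices form M = (form M).flip by nth_rw 1 [this]; rfl
  ext i j
  simp [form, M.symmetric i j]

/-- The simple reflections as linear automorphisms. -/
noncomputable def reflection (M : CoxeterMatrix B) (i : B) : (B →₀ ℝ) ≃ₗ[ℝ] (B →₀ ℝ) :=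
  Module.reflection (form_simple_self (M := M) i)

theorem reflection_apply (i : B) (v : B →₀ ℝ) :
    reflection M i v = v - form M v (simpleRoot i) • simpleRoot i := by
  rw [reflection, Module.reflection_apply, form_symm]

theorem isLiftable_reflection (hcrys : ∀ i j : B, i ≠ j → M i j ∈ ({2, 3, 4, 6} : Set ℕ)) :
    M.IsLiftable (reflection M) := by
  intro i j
  by_cases hij : i = j
  · subst hij
    refine LinearEquiv.ext fun v => ?_
    rw [M.diagonal, pow_one, LinearEquiv.mul_apply]
    exact Module.involutive_reflection (form_simple_self (M := M) i) v
  · refine LinearEquiv.toLinearMap_injective ?_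
    have h1 : form M (simpleRoot i) (simpleRoot j) = -bond (M i j) := form_simple i j
    have h2 : form M (simpleRoot j) (simpleRoot i) = -bond (M i j) := by
      rw [form_simple, M.symmetric]
    unfold reflection
    rw [Module.reflection_mul_reflection_pow _ _ _
      (form M (simpleRoot i) (simpleRoot j) * form M (simpleRoot j) (simpleRoot i) - 2) rfl, h1, h2]
    have h3 := hcrys i j hij
    have e1 : Polynomial.Chebyshev.S ℝ 3 = Polynomial.X ^ 3 - 2 * Polynomial.X := by
      rw [Polynomial.Chebyshev.S_eq]; norm_num [Polynomial.Chebyshev.S_two]; ring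
    rcases h3 with h | h | h | h <;> rw [h] <;>
      norm_num [bond, Polynomial.Chebyshev.S_two, e1]
    refine LinearMap.ext fun v => ?_
    simp
    abel

/-- The geometric representation. -/
noncomputable def rep (cs : CoxeterSystem M W)
    (hcrys : ∀ i j : B, i ≠ j → M i j ∈ ({2, 3, 4, 6} : Set ℕ)) :
    W →* Module.End ℝ (B →₀ ℝ) :=
  (LinearEquiv.automorphismGroup.toLinearMapMonoidHom).comp
    (cs.lift ⟨reflection M, isLiftable_reflection hcrys⟩)

variable (cs : CoxeterSystem M W)
  (hcrys : ∀ i j : B, i ≠ j → M i j ∈ ({2, 3, 4, 6} : Set ℕ))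

theorem rep_simple (i : B) (v : B →₀ ℝ) :
    rep cs hcrys (cs.simple i) v = v - form M v (simpleRoot i) • simpleRoot i := by
  rw [← reflection_apply]
  simp [rep]

theorem rep_mul (x y : W) (v : B →₀ ℝ) :
    rep cs hcrys (x * y) v = rep cs hcrys x (rep cs hcrys y v) := by
  rw [map_mul]; rfl

theorem rep_apply_inv (x : W) (v : B →₀ ℝ) : rep cs hcrys x (rep cs hcrys x⁻¹ v) = v := by
  rw [← rep_mul, mul_inv_cancel, map_one]; rfl

theorem form_rep (w : W) : ∀ x y, form M (rep cs hcrys w x) (rep cs hcrys w y) = form M x y := by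
  induction w using cs.simple_induction with
  | simple i =>
    intro x y
    rw [rep_simple, rep_simple]
    simp only [map_sub, map_smul, LinearMap.sub_apply, LinearMap.smul_apply, smul_eq_mul,
      form_simple_self, form_symm (simpleRoot i)]
    ring
  | one => intro x y; rw [map_one]; rfl
  | mul u v hu hv => intro x y; rw [rep_mul, rep_mul, hu, hv]

theorem rep_conj_simple (w : W) (i : B) (v : B →₀ ℝ) :
    rep cs hcrys (w * cs.simple i * w⁻¹) v =
      v - form M v (rep cs hcrys w (simpleRoot i)) • rep cs hcrys w (simpleRoot i) := by
  rw [rep_mul, rep_mul, rep_simple, map_sub, map_smul, rep_apply_inv, ← form_rep cs hcrys w,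
    rep_apply_inv]

theorem rep_mul_simple (w : W) (i : B) :
    rep cs hcrys (w * cs.simple i) (simpleRoot i) = -rep cs hcrys w (simpleRoot i) := by
  rw [rep_mul, rep_simple, form_simple_self, ← map_neg, two_smul]
  congr 1; abel

/-- The coefficients of roots in rank two, see `rep_alternatingWord`. -/
noncomputable def rankTwoCoeff (κ : ℝ) : ℕ → ℝ
  | 0 => 0
  | 1 => 1
  | k + 2 => κ * rankTwoCoeff κ (k + 1) - rankTwoCoeff κ k

theorem rankTwoCoeff_nonneg {m : ℕ} (hm : m ∈ ({2, 3, 4, 6} : Set ℕ)) {k : ℕ} (hk : k ≤ m) :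
    0 ≤ rankTwoCoeff (bond m) k := by
  have h2 : √2 * √2 = 2 := Real.mul_self_sqrt (by norm_num)
  have h3 : √3 * √3 = 3 := Real.mul_self_sqrt (by norm_num)
  have h20 := Real.sqrt_nonneg 2
  have h30 := Real.sqrt_nonneg 3
  rcases hm with rfl | rfl | rfl | rfl <;> interval_cases k <;>
    norm_num [rankTwoCoeff, bond, h2, h3] <;> nlinarith

theorem rep_alternatingWord {i j : B} (k : ℕ) :
    rep cs hcrys (cs.wordProd (CoxeterSystem.alternatingWord i j k)) (simpleRoot i) =
      if Even k then rankTwoCoeff (bond (M i j)) (k + 1) • simpleRoot i +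
        rankTwoCoeff (bond (M i j)) k • simpleRoot j
      else rankTwoCoeff (bond (M i j)) k • simpleRoot i +
        rankTwoCoeff (bond (M i j)) (k + 1) • simpleRoot j := by
  induction k with
  | zero => simp [CoxeterSystem.alternatingWord, rankTwoCoeff]
  | succ k ih =>
    rw [CoxeterSystem.alternatingWord_succ', cs.wordProd_cons, rep_mul, ih]
    by_cases hk : Even k
    · simp only [hk, if_true, Nat.even_add_one, not_true, if_false, rep_simple, map_add, map_smul,
        form_simple_self, form_simple, rankTwoCoeff]
      module
    · simp only [hk, if_false, Nat.even_add_one, not_false_eq_true, if_true, rep_simple, map_add,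
        map_smul, form_simple_self, form_simple, rankTwoCoeff, M.symmetric j i]
      module

/-- An element lengthened by a simple reflection maps the simple root to a nonnegative
combination of simple roots. -/
theorem rep_simpleRoot_nonneg (w : W) (i : B) (hw : ¬ cs.IsRightDescent w i) :
    0 ≤ rep cs hcrys w (simpleRoot i) := by
  induction hn : cs.length w using Nat.strong_induction_on generalizing w i with
  | _ n ih =>
    by_cases h1 : w = 1
    · rw [h1, map_one]; exact Finsupp.single_nonneg.mpr zero_le_one
    obtain ⟨j, hj⟩ := cs.exists_rightDescent_of_ne_one h1
    have hij : i ≠ j := by rintro rfl; exact hw hj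
    have hm := hcrys i j hij
    set u : ℕ → W := fun k => cs.wordProd (CoxeterSystem.alternatingWord i j k) with hu
    have hu0 : u 0 = 1 := by simp [hu, CoxeterSystem.alternatingWord]
    have hsucc : ∀ k, u (k + 1) = cs.simple (if Even k then j else i) * u k := fun k => by
      rw [hu]; simp only; rw [CoxeterSystem.alternatingWord_succ', cs.wordProd_cons]
    have hulen : ∀ k, cs.length (u k) ≤ k := fun k =>
      (cs.length_wordProd_le _).trans_eq (CoxeterSystem.length_alternatingWord i j k)
    have hge : ∀ k, cs.length w ≤ cs.length (w * (u k)⁻¹) + k := fun k => by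
      have := cs.length_le_length_mul_add_right w (u k)⁻¹
      rw [cs.length_inv] at this
      have := hulen k
      omega
    have hstep : ∀ k, w * (u (k + 1))⁻¹ = w * (u k)⁻¹ * cs.simple (if Even k then j else i) :=
      fun k => by rw [hsucc, mul_inv_rev, cs.inv_simple, mul_assoc]
    classical
    obtain ⟨k, hk1, hkm, hQk, hmax⟩ : ∃ k, 1 ≤ k ∧ k ≤ M i j ∧
        cs.length (w * (u k)⁻¹) + k = cs.length w ∧
        (k < M i j → cs.length (w * (u (k + 1))⁻¹) + (k + 1) ≠ cs.length w) := by
      let Q : ℕ → Prop := fun k => cs.length (w * (u k)⁻¹) + k = cs.length w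
      have hm1 : 1 ≤ M i j := by
        simp only [Set.mem_insert_iff, Set.mem_singleton_iff] at hm
        omega
      have hQ1 : Q 1 := by
        have := hstep 0
        simp only [zero_add, hu0, inv_one, mul_one, Even.zero, if_true] at this
        simp only [Q, this]
        exact cs.isRightDescent_iff.mp hj
      exact ⟨Nat.findGreatest Q (M i j), Nat.le_findGreatest hm1 hQ1, Nat.findGreatest_le _,
        Nat.findGreatest_spec hm1 hQ1, fun h =>
          Nat.findGreatest_is_greatest (P := Q) (Nat.lt_succ_self _) h⟩
    have hkne : k ≠ M i j := by
      intro h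
      obtain ⟨m, hm⟩ : ∃ m, M i j = m + 1 := ⟨M i j - 1, by omega⟩
      have e : u m = u k * cs.simple i := by
        simp only [hu, h]
        rw [cs.wordProd_braidWord_eq i j, CoxeterSystem.braidWord, M.symmetric j i, hm,
          CoxeterSystem.alternatingWord_succ, cs.wordProd_concat,
          cs.simple_mul_simple_cancel_right]
      apply hw
      have e2 : w * cs.simple i = w * (u k)⁻¹ * u m := by
        rw [e, ← mul_assoc, inv_mul_cancel_right]
      have := cs.length_mul_le (w * (u k)⁻¹) (u m)
      have := hulen m
      unfold CoxeterSystem.IsRightDescent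
      rw [e2]
      omega
    replace hmax := hmax (by omega)
    obtain ⟨z, hz⟩ : ∃ z, z = w * (u k)⁻¹ := ⟨_, rfl⟩
    rw [hstep, ← hz] at hmax
    rw [← hz] at hQk
    have hzlen : cs.length z < n := by omega
    have hA : ¬ cs.IsRightDescent z (if Even k then j else i) := by
      intro h
      have := cs.isRightDescent_iff.mp h
      omega
    have hB : ¬ cs.IsRightDescent z (if Even k then i else j) := by
      obtain ⟨l, hl⟩ : ∃ l, k = l + 1 := ⟨k - 1, by omega⟩
      have e : z = w * (u l)⁻¹ * cs.simple (if Even k then i else j) := by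
        rw [hz, hl, hstep]
        by_cases h : Even l <;> simp [h, Nat.even_add_one]
      unfold CoxeterSystem.IsRightDescent
      rw [e, cs.simple_mul_simple_cancel_right, ← e]
      have := hge l
      omega
    have hi : ¬ cs.IsRightDescent z i := by
      by_cases h : Even k
      · simpa [h] using hB
      · simpa [h] using hA
    have hj : ¬ cs.IsRightDescent z j := by
      by_cases h : Even k
      · simpa [h] using hA
      · simpa [h] using hB
    have hzi := ih _ hzlen z i hi rfl
    have hzj := ih _ hzlen z j hj rfl
    have hw' : w = z * u k := by rw [hz, inv_mul_cancel_right]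
    have c1 := rankTwoCoeff_nonneg hm hkm
    have c2 := rankTwoCoeff_nonneg hm (k := k + 1) (by omega)
    rw [hw', rep_mul, hu]
    simp only
    rw [rep_alternatingWord]
    split_ifs
    · rw [map_add, map_smul, map_smul]
      exact add_nonneg (smul_nonneg c2 hzi) (smul_nonneg c1 hzj)
    · rw [map_add, map_smul, map_smul]
      exact add_nonneg (smul_nonneg c1 hzi) (smul_nonneg c2 hzj)

/-- The sum of the coordinates with respect to the simple roots. -/
noncomputable def height : (B →₀ ℝ) →ₗ[ℝ] ℝ := Finsupp.linearCombination ℝ fun _ => 1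

theorem height_pos {v : B →₀ ℝ} (hv : 0 ≤ v) (hne : v ≠ 0) : 0 < height v := by
  have h1 : height v = v.sum fun _ x => x := by simp [height, Finsupp.linearCombination_apply]
  rw [h1]
  refine Finset.sum_pos (fun i hi => lt_of_le_of_ne (hv i) ?_)
    (Finsupp.support_nonempty_iff.mpr hne)
  exact (Finsupp.mem_support_iff.mp hi).symm

theorem height_simpleRoot (i : B) : height (simpleRoot i) = 1 := by simp [height]

/-- The roots: the orbit of the simple roots. -/
def roots : Set (B →₀ ℝ) := {v | ∃ w i, rep cs hcrys w (simpleRoot i) = v}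

variable {cs hcrys}

theorem form_self_of_mem {v : B →₀ ℝ} (hv : v ∈ roots cs hcrys) : form M v v = 2 := by
  obtain ⟨w, i, rfl⟩ := hv
  rw [form_rep, form_simple_self]

theorem ne_zero_of_mem {v : B →₀ ℝ} (hv : v ∈ roots cs hcrys) : v ≠ 0 := by
  rintro rfl
  have := form_self_of_mem hv
  simp at this

theorem neg_mem_roots {v : B →₀ ℝ} (hv : v ∈ roots cs hcrys) : -v ∈ roots cs hcrys := by
  obtain ⟨w, i, rfl⟩ := hv
  exact ⟨w * cs.simple i, i, rep_mul_simple cs hcrys w i⟩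

theorem nonneg_or_nonpos {v : B →₀ ℝ} (hv : v ∈ roots cs hcrys) : 0 ≤ v ∨ 0 ≤ -v := by
  obtain ⟨w, i, rfl⟩ := hv
  by_cases h : cs.IsRightDescent w i
  · right
    rw [← rep_mul_simple]
    exact rep_simpleRoot_nonneg cs hcrys _ _ (cs.isRightDescent_iff_not_isRightDescent_mul.mp h)
  · exact Or.inl (rep_simpleRoot_nonneg cs hcrys _ _ h)

theorem height_ne_zero {v : B →₀ ℝ} (hv : v ∈ roots cs hcrys) : height v ≠ 0 := by
  rcases nonneg_or_nonpos hv with h | h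
  · exact (height_pos h (ne_zero_of_mem hv)).ne'
  · have := height_pos h (neg_ne_zero.mpr (ne_zero_of_mem hv))
    rw [map_neg] at this
    linarith

theorem nonneg_of_height_pos {v : B →₀ ℝ} (hv : v ∈ roots cs hcrys) (h : 0 < height v) :
    0 ≤ v := by
  refine (nonneg_or_nonpos hv).resolve_right fun h' => ?_
  have := height_pos h' (neg_ne_zero.mpr (ne_zero_of_mem hv))
  rw [map_neg] at this
  linarith

theorem rep_injective : Function.Injective (rep cs hcrys) := by
  rw [injective_iff_map_eq_one]
  intro w hw
  by_contra hne
  obtain ⟨i, hi⟩ := cs.exists_rightDescent_of_ne_one hne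
  have h := rep_simpleRoot_nonneg cs hcrys _ _ (cs.isRightDescent_iff_not_isRightDescent_mul.mp hi)
  rw [rep_mul_simple, hw] at h
  have := h i
  simp only [Module.End.one_apply, Finsupp.coe_zero, Pi.zero_apply, Finsupp.coe_neg, Pi.neg_apply,
    Finsupp.single_eq_same] at this
  linarith

theorem simple_injective {hcrys : ∀ i j : B, i ≠ j → M i j ∈ ({2, 3, 4, 6} : Set ℕ)} :
    Function.Injective cs.simple := by
  intro i j hij
  by_contra hne
  have h1 := rep_simple cs hcrys i (simpleRoot i)
  rw [hij, rep_simple] at h1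
  have h2 := DFunLike.congr_fun h1 i
  simp [form_simple_self, hne] at h2
  norm_num at h2

theorem finite_roots [Finite W] : (roots cs hcrys).Finite := by
  have : Finite B := Finite.of_injective cs.simple (simple_injective (hcrys := hcrys))
  refine (Set.finite_range fun x : W × B => rep cs hcrys x.1 (simpleRoot x.2)).subset ?_
  rintro _ ⟨w, i, rfl⟩
  exact ⟨(w, i), rfl⟩

theorem isLiftable_neg_one : M.IsLiftable fun _ : B => (-1 : ℤˣ) := by
  intro i j
  simp

theorem eq_conj_of_apply {t w : W} {i : B}
    (h : ∀ v, rep cs hcrys t v = v - form M v (rep cs hcrys w (simpleRoot i)) •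
      rep cs hcrys w (simpleRoot i)) : t = w * cs.simple i * w⁻¹ :=
  rep_injective (hcrys := hcrys) (LinearMap.ext fun v => by rw [h, rep_conj_simple])

/-- The geometric representation of a Weyl group with its roots. -/
noncomputable def rootRep [Finite W] (cs : CoxeterSystem M W)
    (hcrys : ∀ i j : B, i ≠ j → M i j ∈ ({2, 3, 4, 6} : Set ℕ)) : RootRep W (B →₀ ℝ) where
  ρ := rep cs hcrys
  form := form M
  ht := height
  roots := roots cs hcrys
  finite_roots := finite_roots
  neg_mem _ := neg_mem_roots
  map_mem := by
    rintro x _ ⟨w, i, rfl⟩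
    exact ⟨x * w, i, rep_mul cs hcrys x w _⟩
  form_symm := form_symm
  form_map := form_rep cs hcrys
  form_self _ := form_self_of_mem
  ht_ne_zero _ := height_ne_zero
  injective := rep_injective
  sign := cs.lift ⟨fun _ => -1, isLiftable_neg_one⟩
  sign_reflection := by
    rintro t _ ⟨w, i, rfl⟩ h
    rw [eq_conj_of_apply h, map_mul, map_mul, cs.lift_apply_simple, map_inv, mul_inv_cancel_comm]

variable (cs hcrys) [Finite W]

theorem exists_isReflectionAt :
    ∀ α ∈ (rootRep cs hcrys).roots, ∃ t, (rootRep cs hcrys).IsReflectionAt t α := by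
  rintro _ ⟨w, i, rfl⟩
  exact ⟨w * cs.simple i * w⁻¹, rep_conj_simple cs hcrys w i⟩

theorem isReflection_iff (t : W) : cs.IsReflection t ↔
    ∃ α ∈ (rootRep cs hcrys).roots, (rootRep cs hcrys).IsReflectionAt t α := by
  constructor
  · rintro ⟨w, i, rfl⟩
    exact ⟨_, ⟨w, i, rfl⟩, rep_conj_simple cs hcrys w i⟩
  · rintro ⟨_, ⟨w, i, rfl⟩, h⟩
    exact ⟨w, i, eq_conj_of_apply h⟩

/-- A simple reflection permutes the other positive roots. -/
theorem height_rep_simple_pos {i : B} {v : B →₀ ℝ} (hv : v ∈ roots cs hcrys) (hv0 : 0 < height v)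
    (hne : v ≠ simpleRoot i) : 0 < height (rep cs hcrys (cs.simple i) v) := by
  have h0 := nonneg_of_height_pos hv hv0
  obtain ⟨j, hji, hj⟩ : ∃ j, j ≠ i ∧ v j ≠ 0 := by
    by_contra! hcon
    have hvi : v = v i • simpleRoot i := by
      ext j
      by_cases h : j = i
      · subst h; simp
      · simp [hcon j h, h]
    have h1 := form_self_of_mem hv
    rw [hvi] at h1
    simp only [map_smul, LinearMap.smul_apply, form_simple_self, smul_eq_mul] at h1
    have h2 : 0 ≤ v i := h0 i
    have h3 : v i = 1 := by nlinarith
    rw [h3, one_smul] at hvi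
    exact hne hvi
  have hmem := (rootRep cs hcrys).map_mem (cs.simple i) v hv
  rcases nonneg_or_nonpos hmem with h | h
  · exact height_pos h (ne_zero_of_mem hmem)
  · exfalso
    have h1 : 0 ≤ -(rep cs hcrys (cs.simple i) v j) := h j
    have h2 : 0 ≤ v j := h0 j
    rw [rep_simple] at h1
    rw [Finsupp.sub_apply, Finsupp.smul_apply, Finsupp.single_eq_of_ne hji, smul_zero,
      sub_zero] at h1
    exact hj (by linarith)

/-- The length is the number of positive roots made negative. -/
theorem length_eq_rank (w : W) : cs.length w = (rootRep cs hcrys).rank ⊤ w := by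
  induction hn : cs.length w generalizing w with
  | zero =>
    rw [cs.length_eq_zero_iff] at hn
    have : (rootRep cs hcrys).inversions ⊤ w = ∅ := by
      rw [Set.eq_empty_iff_forall_notMem]
      rintro α ⟨-, -, h1, h2⟩
      rw [hn, map_one, Module.End.one_apply] at h2
      linarith
    rw [RootRep.rank, this, Set.ncard_empty]
  | succ n ih =>
    have hne : w ≠ 1 := by rintro rfl; simp at hn
    obtain ⟨i, hi⟩ := cs.exists_rightDescent_of_ne_one hne
    have hi' := cs.isRightDescent_iff_not_isRightDescent_mul.mp hi
    have hlen := cs.isRightDescent_iff.mp hi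
    rw [ih (w * cs.simple i) (by omega)]
    have hroot : simpleRoot i ∈ roots cs hcrys := ⟨1, i, by rw [map_one]; rfl⟩
    have hrefl : (rootRep cs hcrys).IsReflectionAt (cs.simple i) (simpleRoot i) :=
      rep_simple cs hcrys i
    have := hrefl.rank_mul hroot (P := ⊤) trivial
      (by change 0 < height (simpleRoot i); rw [height_simpleRoot]; norm_num)
      (fun γ h1 _ h2 h3 => height_rep_simple_pos cs hcrys h1 h2 h3)
      (z := w * cs.simple i)
      (height_pos (rep_simpleRoot_nonneg cs hcrys _ _ hi')
        (ne_zero_of_mem (cs := cs) (hcrys := hcrys) ⟨_, i, rfl⟩))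
    rw [cs.simple_mul_simple_cancel_right] at this
    exact this.symm

end Geometric

/-! ### Edges of the Bruhat graph inside an interval -/

section Interval

variable {cs : CoxeterSystem M W} {u w : W}

theorem BruhatStep.isReflection {a b : W} (h : BruhatStep cs a b) : cs.IsReflection (a⁻¹ * b) := by
  obtain ⟨t, ht, rfl, -⟩ := h
  have := ht.conj a⁻¹
  rwa [inv_inv, mul_assoc] at this

theorem bruhatStep_of_isReflection {a b : W} (h : cs.IsReflection (a⁻¹ * b))
    (hlt : cs.length a < cs.length b) : BruhatStep cs a b :=
  ⟨a * (a⁻¹ * b) * a⁻¹, h.conj a, by group, hlt⟩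

theorem not_isReflection_inv_mul_self (a : W) : ¬ cs.IsReflection (a⁻¹ * a) := fun h => by
  have := h.odd_length
  rw [inv_mul_cancel, cs.length_one] at this
  exact absurd this (by decide)

theorem length_lt_of_lt {a b : BruhatInterval cs u w} (h : a < b) :
    cs.length a.1 < cs.length b.1 :=
  BruhatLE.length_lt h.le fun e => h.ne (Subtype.ext e)

theorem length_add_two_le {a b : BruhatInterval cs u w} (h : a < b) (hcov : ¬ a ⋖ b) :
    cs.length a.1 + 2 ≤ cs.length b.1 := by
  obtain ⟨c, hac, hcb⟩ := (not_covBy_iff h).mp hcov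
  have := length_lt_of_lt hac
  have := length_lt_of_lt hcb
  omega

theorem lt_of_isReflection {a b : BruhatInterval cs u w} (h : cs.IsReflection (a.1⁻¹ * b.1))
    (hlt : cs.length a.1 < cs.length b.1) : a < b :=
  lt_of_le_of_ne (Relation.ReflTransGen.single (bruhatStep_of_isReflection h hlt))
    fun e => hlt.ne (by rw [e])

variable [Finite W]

/-- An edge of an interval that is not a cover is spanned by two crossing pairs of shorter paths
inside the interval. -/
theorem exists_crossing
    (hcrys : ∀ i j : B, i ≠ j → M i j ∈ ({2, 3, 4, 6} : Set ℕ))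
    {a b : BruhatInterval cs u w} (h : cs.IsReflection (a.1⁻¹ * b.1))
    (hlt : cs.length a.1 + 2 ≤ cs.length b.1) :
    ∃ p q : Fin 2 → BruhatInterval cs u w, p 0 ≠ p 1 ∧ q 0 ≠ q 1 ∧
      (∀ i, a < p i ∧ cs.IsReflection (a.1⁻¹ * (p i).1)) ∧
      (∀ i, q i < b ∧ cs.IsReflection ((q i).1⁻¹ * b.1)) ∧
      ∀ i j, p i < q j ∧ cs.IsReflection ((p i).1⁻¹ * (q j).1) := by
  obtain ⟨α, hα, hα0, hrefl⟩ : ∃ α ∈ (Geometric.rootRep cs hcrys).roots,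
      0 < (Geometric.rootRep cs hcrys).ht α ∧
        (Geometric.rootRep cs hcrys).IsReflectionAt (a.1⁻¹ * b.1) α := by
    obtain ⟨α, h1, h2⟩ := (Geometric.isReflection_iff cs hcrys _).mp h
    by_cases h3 : 0 < (Geometric.rootRep cs hcrys).ht α
    · exact ⟨α, h1, h3, h2⟩
    · have := RootRep.ht_neg_of_not_pos h1 h3
      exact ⟨-α, RootRep.neg_mem _ _ h1, by rw [map_neg]; linarith, h2.neg⟩
  rw [Geometric.length_eq_rank cs hcrys, Geometric.length_eq_rank cs hcrys] at hlt
  obtain ⟨p, q, hp, hq, hall⟩ := RootRep.exists_crossing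
    (Geometric.exists_isReflectionAt cs hcrys) hα hα0 hrefl hlt
  simp only [← Geometric.isReflection_iff, ← Geometric.length_eq_rank] at hall
  have hap : ∀ i, BruhatLE cs a.1 (p i) := fun i =>
    .single (bruhatStep_of_isReflection (hall i).1.1 (hall i).1.2)
  have hqb : ∀ i, BruhatLE cs (q i) b.1 := fun i =>
    .single (bruhatStep_of_isReflection (hall i).2.1.1 (hall i).2.1.2)
  have hpq : ∀ i j, BruhatLE cs (p i) (q j) := fun i j =>
    .single (bruhatStep_of_isReflection ((hall i).2.2 j).1 ((hall i).2.2 j).2)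
  refine ⟨fun i => ⟨p i, a.2.1.trans (hap i), ((hpq i i).trans (hqb i)).trans b.2.2⟩,
    fun j => ⟨q j, (a.2.1.trans (hap j)).trans (hpq j j), (hqb j).trans b.2.2⟩,
    fun e => hp (congrArg Subtype.val e), fun e => hq (congrArg Subtype.val e),
    fun i => ⟨lt_of_isReflection (hall i).1.1 (hall i).1.2, (hall i).1.1⟩,
    fun i => ⟨lt_of_isReflection (hall i).2.1.1 (hall i).2.1.2, (hall i).2.1.1⟩,
    fun i j => ⟨lt_of_isReflection ((hall i).2.2 j).1 ((hall i).2.2 j).2, ((hall i).2.2 j).1⟩⟩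

theorem isReflection_of_crossing
    (hcrys : ∀ i j : B, i ≠ j → M i j ∈ ({2, 3, 4, 6} : Set ℕ))
    {x y : W} {p q : Fin 2 → W} (hp : p 0 ≠ p 1) (hq : q 0 ≠ q 1)
    (hxp : ∀ i, cs.IsReflection (x⁻¹ * p i)) (hqy : ∀ i, cs.IsReflection ((q i)⁻¹ * y))
    (hpq : ∀ i j, cs.IsReflection ((p i)⁻¹ * q j)) : cs.IsReflection (x⁻¹ * y) := by
  simp only [Geometric.isReflection_iff cs hcrys] at hxp hqy hpq ⊢
  exact RootRep.exists_root_of_crossing (Geometric.exists_isReflectionAt cs hcrys) hp hq hxp hpq hqy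

theorem isReflection_of_covBy
    (hcrys : ∀ i j : B, i ≠ j → M i j ∈ ({2, 3, 4, 6} : Set ℕ))
    {a b : BruhatInterval cs u w} (h : a ⋖ b) :
    cs.IsReflection (a.1⁻¹ * b.1) ∧ cs.length b.1 = cs.length a.1 + 1 := by
  have hE : cs.IsReflection (a.1⁻¹ * b.1) := by
    rcases Relation.ReflTransGen.cases_head (show BruhatLE cs a.1 b.1 from h.le) with
      e | ⟨c, hc, hcb⟩
    · exact absurd (Subtype.ext e) h.ne
    · have hac : BruhatLE cs a.1 c := .single hc
      have hlt : a < (⟨c, a.2.1.trans hac, .trans hcb b.2.2⟩ : BruhatInterval cs u w) :=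
        lt_of_isReflection hc.isReflection (by obtain ⟨-, -, -, h⟩ := hc; exact h)
      have hle : (⟨c, a.2.1.trans hac, .trans hcb b.2.2⟩ : BruhatInterval cs u w) ≤ b := hcb
      rw [← (eq_of_le_of_not_lt hle fun h' => h.2 hlt h')]
      exact hc.isReflection
  refine ⟨hE, ?_⟩
  have := length_lt_of_lt h.lt
  by_contra hne
  obtain ⟨p, q, -, -, h1, h2, h3⟩ := exists_crossing hcrys hE (by omega)
  exact h.2 (h1 0).1 ((h3 0 0).1.trans (h2 0).1)

end Interval

section Transfer

variable {B' W' : Type*} [Group W'] {M' : CoxeterMatrix B'} [Finite W] [Finite W']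
  {cs : CoxeterSystem M W} {cs' : CoxeterSystem M' W'} {u w : W} {u' w' : W'}

/-- Isomorphisms of Bruhat intervals preserve the edges of the Bruhat graph. -/
theorem isReflection_map
    (hcrys : ∀ i j : B, i ≠ j → M i j ∈ ({2, 3, 4, 6} : Set ℕ))
    (hcrys' : ∀ i j : B', i ≠ j → M' i j ∈ ({2, 3, 4, 6} : Set ℕ))
    (e : BruhatInterval cs u w ≃o BruhatInterval cs' u' w')
    {a b : BruhatInterval cs u w} (hab : a < b) (h : cs.IsReflection (a.1⁻¹ * b.1)) :
    cs'.IsReflection ((e a).1⁻¹ * (e b).1) := by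
  induction hn : cs.length b.1 - cs.length a.1 using Nat.strong_induction_on generalizing a b with
  | _ n ih =>
    by_cases hcov : a ⋖ b
    · exact (isReflection_of_covBy hcrys' ((apply_covBy_apply_iff e).mpr hcov)).1
    obtain ⟨p, q, hp, hq, h1, h2, h3⟩ := exists_crossing hcrys h (length_add_two_le hab hcov)
    have l1 := fun i => length_lt_of_lt (h1 i).1
    have l2 := fun i => length_lt_of_lt (h2 i).1
    have l3 := fun i j => length_lt_of_lt (h3 i j).1
    refine isReflection_of_crossing hcrys' (p := fun i => (e (p i)).1) (q := fun i => (e (q i)).1)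
      (fun h => hp (e.injective (Subtype.ext h))) (fun h => hq (e.injective (Subtype.ext h)))
      (fun i => ih _ ?_ (h1 i).1 (h1 i).2 rfl) (fun i => ih _ ?_ (h2 i).1 (h2 i).2 rfl)
      (fun i j => ih _ ?_ (h3 i j).1 (h3 i j).2 rfl)
    · have := l1 i; have := l2 i; have := l3 i i; omega
    · have := l1 i; have := l2 i; have := l3 i i; omega
    · have := l1 i; have := l2 j; have := l3 i j; omega

theorem length_map
    (hcrys : ∀ i j : B, i ≠ j → M i j ∈ ({2, 3, 4, 6} : Set ℕ))
    (hcrys' : ∀ i j : B', i ≠ j → M' i j ∈ ({2, 3, 4, 6} : Set ℕ))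
    (e : BruhatInterval cs u w ≃o BruhatInterval cs' u' w')
    {a b : BruhatInterval cs u w} (hab : a ≤ b) :
    cs.length b.1 + cs'.length (e a).1 = cs.length a.1 + cs'.length (e b).1 := by
  induction hn : cs.length b.1 - cs.length a.1 using Nat.strong_induction_on generalizing a b with
  | _ n ih =>
    rcases hab.eq_or_lt with rfl | hlt
    · rfl
    by_cases hcov : a ⋖ b
    · have h1 := (isReflection_of_covBy hcrys hcov).2
      have h2 := (isReflection_of_covBy hcrys' ((apply_covBy_apply_iff e).mpr hcov)).2
      omega
    obtain ⟨c, hac, hcb⟩ := (not_covBy_iff hlt).mp hcov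
    have l1 := length_lt_of_lt hac
    have l2 := length_lt_of_lt hcb
    have h1 := ih _ (by omega) hac.le rfl
    have h2 := ih _ (by omega) hcb.le rfl
    omega

theorem isReflection_map_iff
    (hcrys : ∀ i j : B, i ≠ j → M i j ∈ ({2, 3, 4, 6} : Set ℕ))
    (hcrys' : ∀ i j : B', i ≠ j → M' i j ∈ ({2, 3, 4, 6} : Set ℕ))
    (e : BruhatInterval cs u w ≃o BruhatInterval cs' u' w')
    (a b : BruhatInterval cs u w) : a ≤ b ∧ cs.IsReflection (a.1⁻¹ * b.1) ↔
      e a ≤ e b ∧ cs'.IsReflection ((e a).1⁻¹ * (e b).1) := by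
  rw [e.le_iff_le]
  refine and_congr_right fun hab => ?_
  rcases hab.eq_or_lt with rfl | hlt
  · simp only [not_isReflection_inv_mul_self]
  · refine ⟨isReflection_map hcrys hcrys' e hlt, fun h => ?_⟩
    simpa using isReflection_map hcrys' hcrys e.symm (e.lt_iff_lt.mpr hlt) h

end Transfer

theorem bruhatDeg_eq_card {cs : CoxeterSystem M W} {u w : W} (y : BruhatInterval cs u w) :
    bruhatDeg cs y.1 w y.1 =
      Nat.card {z : BruhatInterval cs u w // y ≤ z ∧ cs.IsReflection (y.1⁻¹ * z.1)} :=
  Nat.card_congr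
    { toFun := fun z => ⟨⟨z.1, .trans y.2.1 z.2.1.1, z.2.1.2⟩, z.2.1.1, z.2.2⟩
      invFun := fun z => ⟨z.1.1, ⟨z.2.1, z.1.2.2⟩, z.2.2⟩
      left_inv := fun _ => rfl
      right_inv := fun _ => rfl }

/-- If two Bruhat intervals in Weyl groups are isomorphic as posets and one
is rationally smooth, then so is the other. -/
theorem rationally_smooth_of_orderIso {B W : Type*} [Group W] [Finite W] {M : CoxeterMatrix B}
    (cs : CoxeterSystem M W)
    (hcrys : ∀ i j : B, i ≠ j → M i j ∈ ({2, 3, 4, 6} : Set ℕ))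
    {B' W' : Type*} [Group W'] [Finite W'] {M' : CoxeterMatrix B'}
    (cs' : CoxeterSystem M' W')
    (hcrys' : ∀ i j : B', i ≠ j → M' i j ∈ ({2, 3, 4, 6} : Set ℕ))
    (u w : W) (huw : BruhatLE cs u w) (hne : u ≠ w)
    (u' w' : W') (huw' : BruhatLE cs' u' w') (hne' : u' ≠ w')
    (iso : BruhatInterval cs u w ≃o BruhatInterval cs' u' w')
    (h : RationallySmooth cs u w) :
    RationallySmooth cs' u' w' := by
  intro y' h1 h2
  obtain ⟨y, hy⟩ := iso.surjective ⟨y', h1, h2⟩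
  have htop : iso ⟨w, huw, .refl⟩ = ⟨w', huw', .refl⟩ := by
    obtain ⟨x, hx⟩ := iso.surjective ⟨w', huw', .refl⟩
    rw [← hx]
    refine le_antisymm ?_ (iso.monotone x.2.2)
    rw [hx]
    exact (iso _).2.2
  have hlen := length_map hcrys hcrys' iso (a := y) (b := ⟨w, huw, .refl⟩) y.2.2
  have hdeg := h y.1 y.2.1 y.2.2
  have hdeg' := bruhatDeg_eq_card (iso y)
  rw [htop] at hlen
  rw [hy] at hlen hdeg'
  rw [hdeg', ← hy, ← Nat.card_congr (iso.toEquiv.subtypeEquiv fun z =>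
    isReflection_map_iff hcrys hcrys' iso y z), ← bruhatDeg_eq_card, hdeg]
  have := BruhatLE.length_le h2
  have := BruhatLE.length_le y.2.2
  simp only at hlen
  omega

end Paper
end

section
/- In the symmetric group S_5 (type A_4, with simple reflections s1, s2, s3, s4), the Bruhat interval I = [s1, s1s3s2s1s4s3] is not isomorphic as a poset to any lower Bruhat interval [e,x] in any symmetric group. -/
namespace Paper

/-! ### Bruhat order on a Coxeter group -/

variable {B W : Type*} [Group W] {M : CoxeterMatrix B}

/-- Bundled data of a Coxeter system of type `A` (a symmetric group). -/
structure TypeAData where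
  {n : ℕ}
  {W : Type}
  [grp : Group W]
  cs : CoxeterSystem (CoxeterMatrix.Aₙ n) W

attribute [instance] TypeAData.grp

section Forks

/-- A poset has a fork if it has a least element and an atom `a` such that, for each of three
distinct atoms `b`, there are two elements above `a` whose principal ideals contain nothing but
the least element, `a`, `b` and the element itself. -/
def HasFork (P : Type*) [PartialOrder P] : Prop :=
  ∃ (o a : P) (b : Fin 3 → P) (y : Fin 3 → Fin 2 → P),
    (∀ z, o ≤ z) ∧ a ≠ o ∧ (∀ z ≤ a, z = o ∨ z = a) ∧
    Function.Injective b ∧ (∀ j, b j ≠ o ∧ ∀ z ≤ b j, z = o ∨ z = b j) ∧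
    ∀ j, y j 0 ≠ y j 1 ∧
      ∀ k, a < y j k ∧ ∀ z ≤ y j k, z = o ∨ z = a ∨ z = b j ∨ z = y j k

theorem HasFork.of_orderIso {P Q : Type*} [PartialOrder P] [PartialOrder Q] (f : P ≃o Q)
    (h : HasFork P) : HasFork Q := by
  obtain ⟨o, a, b, y, ho, hao, ha, hb, hb', hy⟩ := h
  refine ⟨f o, f a, fun j ↦ f (b j), fun j k ↦ f (y j k), ?_, ?_, ?_, ?_, ?_, ?_⟩
  · exact f.surjective.forall.2 fun z ↦ by simpa using ho z
  · simpa using hao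
  · exact f.surjective.forall.2 fun z ↦ by simpa using ha z
  · exact f.injective.comp hb
  · exact fun j ↦ ⟨by simpa using (hb' j).1,
      f.surjective.forall.2 fun z ↦ by simpa using (hb' j).2 z⟩
  · exact fun j ↦ ⟨by simpa using (hy j).1, fun k ↦ ⟨by simpa using ((hy j).2 k).1,
      f.surjective.forall.2 fun z ↦ by simpa using ((hy j).2 k).2 z⟩⟩

end Forks

section LowerIntervals

variable {cs : CoxeterSystem M W}

theorem bruhatLE_simple_mul_of_isLeftDescent {w : W} {i : B} (h : cs.IsLeftDescent w i) :
    BruhatLE cs (cs.simple i * w) w :=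
  .single ⟨cs.simple i, cs.isReflection_simple i, by simp, h⟩

theorem one_bruhatLE (w : W) : BruhatLE cs 1 w := by
  induction hn : cs.length w using Nat.strong_induction_on generalizing w with
  | _ n ih =>
    by_cases hw : w = 1
    · exact hw ▸ .refl
    · obtain ⟨i, hi⟩ := cs.exists_leftDescent_of_ne_one hw
      exact (ih _ (hn ▸ hi) _ rfl).trans (bruhatLE_simple_mul_of_isLeftDescent hi)

/-- A Bruhat relation between elements whose lengths differ by at most one is an equality or a
single step. -/
theorem BruhatLE.eq_or_step {a b : W} (h : BruhatLE cs a b)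
    (hl : cs.length b ≤ cs.length a + 1) : a = b ∨ BruhatStep cs a b := by
  rcases Relation.ReflTransGen.cases_tail h with h' | ⟨c, hc, h'⟩
  · exact .inl h'.symm
  · by_cases hac : a = c
    · exact .inr (hac ▸ h')
    · have h1 := BruhatLE.length_lt hc hac
      obtain ⟨t, -, -, hlt⟩ := h'
      omega

variable {x : W} {o : BruhatInterval cs 1 x}

theorem val_eq_one_of_least (ho : ∀ z, o ≤ z) : o.1 = 1 :=
  BruhatLE.antisymm (ho ⟨1, .refl, one_bruhatLE x⟩) (one_bruhatLE _)

theorem exists_simple_of_atom (ho : ∀ z, o ≤ z) {a : BruhatInterval cs 1 x} (hao : a ≠ o)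
    (ha : ∀ z ≤ a, z = o ∨ z = a) : ∃ i, a.1 = cs.simple i := by
  have ho1 := val_eq_one_of_least ho
  obtain ⟨i, hi⟩ := cs.exists_leftDescent_of_ne_one (w := a.1)
    fun h ↦ hao (Subtype.ext (h.trans ho1.symm))
  have hle := bruhatLE_simple_mul_of_isLeftDescent hi
  refine ⟨i, ?_⟩
  rcases ha ⟨_, one_bruhatLE _, hle.trans a.2.2⟩ hle with h | h
  · have h' : cs.simple i * a.1 = 1 := (congrArg Subtype.val h).trans ho1
    rw [← cs.simple_mul_simple_cancel_left (w := a.1) i, h', mul_one]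
  · have h' : cs.simple i * a.1 = a.1 := congrArg Subtype.val h
    rw [CoxeterSystem.IsLeftDescent, h'] at hi
    exact absurd hi (lt_irrefl _)

theorem eq_simple_mul_simple_of_two_atoms (ho : ∀ z, o ≤ z) {a b y : BruhatInterval cs 1 x}
    {i j : B} (ha : a.1 = cs.simple i) (hb : b.1 = cs.simple j) (hay : a < y)
    (hy : ∀ z ≤ y, z = o ∨ z = a ∨ z = b ∨ z = y) :
    y.1 = cs.simple i * cs.simple j ∨ y.1 = cs.simple j * cs.simple i := by
  have ho1 := val_eq_one_of_least ho
  have hlen : 1 < cs.length y.1 := by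
    have := BruhatLE.length_lt (cs := cs) hay.le fun h ↦ hay.ne (Subtype.ext h)
    rwa [ha, cs.length_simple] at this
  obtain ⟨r, hr⟩ := cs.exists_leftDescent_of_ne_one (w := y.1) fun h ↦ by simp [h] at hlen
  have hle := bruhatLE_simple_mul_of_isLeftDescent hr
  have hyr : y.1 = cs.simple r * (cs.simple r * y.1) := by simp
  have hlr := cs.isLeftDescent_iff.1 hr
  have hdesc : cs.length (cs.simple r * y.1) = 1 ∧
      (cs.simple r * y.1 = cs.simple i ∨ cs.simple r * y.1 = cs.simple j) := by
    rcases hy ⟨_, one_bruhatLE _, hle.trans y.2.2⟩ hle with h | h | h | h <;>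
      replace h := congrArg Subtype.val h <;> dsimp only at h
    · rw [h, ho1, cs.length_one] at hlr
      omega
    · rw [h, ha]
      exact ⟨cs.length_simple i, .inl rfl⟩
    · rw [h, hb]
      exact ⟨cs.length_simple j, .inr rfl⟩
    · rw [h] at hlr
      omega
  obtain ⟨hl1, hz⟩ := hdesc
  have hry : BruhatLE cs (cs.simple r) y.1 := by
    refine .single ⟨cs.simple r * (cs.simple r * y.1) * (cs.simple r)⁻¹, ?_, ?_, ?_⟩
    · rcases hz with h | h <;> rw [h] <;> exact (cs.isReflection_simple _).conj _
    · simp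
    · rw [cs.length_simple]
      exact hlen
  have hr' : cs.simple r = cs.simple i ∨ cs.simple r = cs.simple j := by
    rcases hy ⟨_, one_bruhatLE _, hry.trans y.2.2⟩ hry with h | h | h | h <;>
      replace h := congrArg Subtype.val h <;> dsimp only at h
    · have := congrArg cs.length (h.trans ho1)
      simp at this
    · exact .inl (h.trans ha)
    · exact .inr (h.trans hb)
    · rw [← h, cs.length_simple] at hlen
      omega
  rcases hz with hz | hz <;> rcases hr' with hr' | hr' <;> rw [hz, hr'] at hyr
  · rw [hyr, cs.simple_mul_simple_self, cs.length_one] at hlen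
    omega
  · exact .inr hyr
  · exact .inl hyr
  · rw [hyr, cs.simple_mul_simple_self, cs.length_one] at hlen
    omega

theorem simple_mul_simple_comm_of_eq_two {i j : B} (h : M i j = 2) :
    cs.simple i * cs.simple j = cs.simple j * cs.simple i := by
  have := cs.simple_mul_simple_pow i j
  rw [h, pow_two, mul_eq_one_iff_eq_inv] at this
  simpa using this

theorem not_hasFork_lower {n : ℕ} (cs : CoxeterSystem (CoxeterMatrix.Aₙ n) W) (x : W) :
    ¬ HasFork (BruhatInterval cs 1 x) := by
  rintro ⟨o, a, b, y, ho, hao, ha, hb, hb', hy⟩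
  obtain ⟨i, hi⟩ := exists_simple_of_atom ho hao ha
  choose c hc using fun j ↦ exists_simple_of_atom ho (hb' j).1 (hb' j).2
  have hcinj : Function.Injective c := fun j k h ↦
    hb (Subtype.ext (by rw [hc, hc, h]))
  have hadj : ∀ j, (c j : ℕ) + 1 = i ∨ (i : ℕ) + 1 = c j := by
    intro j
    have hne : cs.simple i * cs.simple (c j) ≠ cs.simple (c j) * cs.simple i := by
      intro h
      apply (hy j).1
      have key := fun k ↦ eq_simple_mul_simple_of_two_atoms ho hi (hc j)
        ((hy j).2 k).1 ((hy j).2 k).2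
      simp only [← h, or_self] at key
      exact Subtype.ext ((key 0).trans (key 1).symm)
    by_contra hnot
    have hij : i ≠ c j := fun h ↦ hne (by rw [← h])
    exact hne (simple_mul_simple_comm_of_eq_two (by simp [CoxeterMatrix.Aₙ, CoxeterMatrix.A, hij, hnot]))
  have h01 : (c 0 : ℕ) ≠ c 1 := fun h ↦ absurd (hcinj (Fin.ext h)) (by decide)
  have h02 : (c 0 : ℕ) ≠ c 2 := fun h ↦ absurd (hcinj (Fin.ext h)) (by decide)
  have h12 : (c 1 : ℕ) ≠ c 2 := fun h ↦ absurd (hcinj (Fin.ext h)) (by decide)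
  have h0 := hadj 0
  have h1 := hadj 1
  have h2 := hadj 2
  omega

end LowerIntervals

section PermutationModel

open Equiv

/-- The inversions of a permutation. -/
def inversions {n : ℕ} (p : Perm (Fin n)) : Finset (Fin n × Fin n) :=
  {q | q.1 < q.2 ∧ p q.2 < p q.1}

theorem mem_inversions {n : ℕ} {p : Perm (Fin n)} {q : Fin n × Fin n} :
    q ∈ inversions p ↔ q.1 < q.2 ∧ p q.2 < p q.1 := by
  simp [inversions]

/-- The product of the adjacent transpositions of `S_{n+1}` indexed by a word. -/
def permOf {n : ℕ} (ω : List (Fin n)) : Perm (Fin (n + 1)) :=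
  (ω.map fun i ↦ swap i.castSucc i.succ).prod

theorem card_inversions_swap_mul_le {n : ℕ} (k : Fin n) (p : Perm (Fin (n + 1))) :
    (inversions (swap k.castSucc k.succ * p)).card ≤ (inversions p).card + 1 := by
  refine (Finset.card_le_card (t := insert (p.symm k.castSucc, p.symm k.succ) (inversions p))
    ?_).trans (Finset.card_insert_le _ _)
  rintro ⟨i, j⟩ hq
  obtain ⟨hij, h⟩ := mem_inversions.1 hq
  rw [Finset.mem_insert, mem_inversions, Prod.mk.injEq, Equiv.eq_symm_apply, Equiv.eq_symm_apply]
  rw [Perm.mul_apply, Perm.mul_apply] at h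
  have hne : p i ≠ p j := fun h ↦ hij.ne (p.injective h)
  generalize p i = u at *
  generalize p j = v at *
  simp only [swap_apply_def] at h
  split_ifs at h <;> simp only [Fin.ext_iff, Fin.lt_def, Fin.val_castSucc, Fin.val_succ] at * <;>
    omega

theorem card_inversions_permOf_le {n : ℕ} (ω : List (Fin n)) :
    (inversions (permOf ω)).card ≤ ω.length := by
  induction ω with
  | nil =>
    rw [List.length_nil, Nat.le_zero, Finset.card_eq_zero, Finset.eq_empty_iff_forall_notMem]
    exact fun q hq ↦ (mem_inversions.1 hq).1.not_gt (mem_inversions.1 hq).2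
  | cons k ω ih =>
    have := card_inversions_swap_mul_le k (permOf ω)
    simp only [permOf, List.map_cons, List.prod_cons, List.length_cons] at this ih ⊢
    omega

variable (cs : CoxeterSystem (CoxeterMatrix.Aₙ 4) W)

/-- The homomorphism from a Coxeter group of type `A₄` to `S₅` sending simple reflections to
adjacent transpositions. -/
def toPerm : W →* Perm (Fin 5) :=
  cs.lift ⟨fun i ↦ swap i.castSucc i.succ, by unfold CoxeterMatrix.IsLiftable; decide⟩

theorem toPerm_simple (i : Fin 4) : toPerm cs (cs.simple i) = swap i.castSucc i.succ :=
  cs.lift_apply_simple _ i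

theorem toPerm_wordProd (ω : List (Fin 4)) : toPerm cs (cs.wordProd ω) = permOf ω := by
  rw [CoxeterSystem.wordProd, map_list_prod, List.map_map, permOf]
  congr 2
  funext i
  exact toPerm_simple cs i

theorem wordProd_ne {ω ω' : List (Fin 4)} (h : permOf ω ≠ permOf ω') :
    cs.wordProd ω ≠ cs.wordProd ω' := fun h' ↦ by
  apply h
  rw [← toPerm_wordProd cs, h', toPerm_wordProd]

theorem card_inversions_toPerm_le (w : W) :
    (inversions (toPerm cs w)).card ≤ cs.length w := by
  obtain ⟨ω, hω, rfl⟩ := cs.exists_isReduced w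
  rw [hω.eq, toPerm_wordProd]
  exact card_inversions_permOf_le ω

theorem length_wordProd_eq {ω : List (Fin 4)} (h : ω.length ≤ (inversions (permOf ω)).card) :
    cs.length (cs.wordProd ω) = ω.length := by
  refine le_antisymm (cs.length_wordProd_le ω) (h.trans ?_)
  rw [← toPerm_wordProd cs]
  exact card_inversions_toPerm_le cs _

/-- Every word obtained by successively deleting letters at the given positions, apart from
possibly the last one, is the word of a permutation with as many inversions as letters. -/
def reducedAlong {n : ℕ} : List (Fin n) → List ℕ → Bool
  | _, [] => true
  | ω, k :: ks => k < ω.length && ω.length ≤ (inversions (permOf ω)).card &&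
      reducedAlong (ω.eraseIdx k) ks

theorem bruhatLE_of_reducedAlong {ω : List (Fin 4)} (ks : List ℕ) (h : reducedAlong ω ks = true) :
    BruhatLE cs (cs.wordProd (ks.foldl List.eraseIdx ω)) (cs.wordProd ω) := by
  induction ks generalizing ω with
  | nil => exact .refl
  | cons k ks ih =>
    simp only [reducedAlong, Bool.and_eq_true, decide_eq_true_eq] at h
    obtain ⟨⟨hk, hω⟩, hks⟩ := h
    refine (ih hks).tail ⟨(cs.leftInvSeq ω).getD k 1, ?_, ?_, ?_⟩
    · apply cs.isReflection_of_mem_leftInvSeq ω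
      rw [List.getD_eq_getElem _ _ (by simpa using hk)]
      exact List.getElem_mem _
    · rw [← cs.getD_leftInvSeq_mul_wordProd, ← mul_assoc, cs.getD_leftInvSeq_mul_self, one_mul]
    · have h1 := cs.length_wordProd_le (ω.eraseIdx k)
      rw [List.length_eraseIdx_of_lt hk] at h1
      rw [length_wordProd_eq cs hω]
      omega

theorem card_support_of_bruhatStep {ω ω' : List (Fin 4)}
    (h : BruhatStep cs (cs.wordProd ω) (cs.wordProd ω')) :
    (permOf ω' * (permOf ω)⁻¹).support.card = 2 := by
  obtain ⟨t, ⟨g, i, rfl⟩, h, -⟩ := h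
  have hp := congrArg (toPerm cs) (eq_mul_inv_of_mul_eq h.symm)
  simp only [map_mul, map_inv, toPerm_wordProd, toPerm_simple] at hp
  rw [← hp, Perm.card_support_conj, Perm.card_support_swap i.castSucc_lt_succ.ne]

theorem eq_or_eq_of_bruhatLE_of_length_le_two {k : Fin 4} {v z : W}
    (hz : BruhatLE cs (cs.simple k) z) (hzv : BruhatLE cs z v) (hv : cs.length v ≤ 2) :
    z = cs.simple k ∨ z = v := by
  by_contra! h
  have h1 := BruhatLE.length_lt hz h.1.symm
  have h2 := BruhatLE.length_lt hzv h.2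
  rw [cs.length_simple] at h1
  omega

theorem exists_word_of_bruhatLE_of_length_eq_three {k : Fin 4} {ω : List (Fin 4)} {z : W}
    (hω : cs.length (cs.wordProd ω) = 3) (hz : BruhatLE cs (cs.simple k) z)
    (hzω : BruhatLE cs z (cs.wordProd ω)) :
    z = cs.simple k ∨ z = cs.wordProd ω ∨ ∃ i j, z = cs.wordProd [i, j] ∧
      (permOf [i, j] * (permOf [k])⁻¹).support.card = 2 ∧
      (permOf ω * (permOf [i, j])⁻¹).support.card = 2 := by
  by_cases h1 : cs.simple k = z
  · exact .inl h1.symm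
  by_cases h2 : z = cs.wordProd ω
  · exact .inr (.inl h2)
  refine .inr (.inr ?_)
  have hl1 := BruhatLE.length_lt hz h1
  have hl2 := BruhatLE.length_lt hzω h2
  rw [cs.length_simple] at hl1
  obtain ⟨ω', hω', rfl⟩ := cs.exists_isReduced z
  have hl : ω'.length = 2 := by
    have := hω'.eq
    omega
  obtain ⟨i, j, rfl⟩ := List.length_eq_two.1 hl
  have hl' := hω'.eq
  refine ⟨i, j, rfl, card_support_of_bruhatStep cs ?_, card_support_of_bruhatStep cs ?_⟩
  · refine (BruhatLE.eq_or_step ?_ ?_).resolve_left ?_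
    · simpa using hz
    · rw [cs.wordProd_singleton, cs.length_simple]
      omega
    · simpa using h1
  · exact (BruhatLE.eq_or_step hzω (by omega)).resolve_left h2

theorem wordProd_swap {i j : Fin 4} (h : CoxeterMatrix.Aₙ 4 i j = 2) :
    cs.wordProd [i, j] = cs.wordProd [j, i] := by
  simpa [CoxeterSystem.wordProd] using simple_mul_simple_comm_of_eq_two h

/-- Words for three of the atoms of `[s₁, s₁s₃s₂s₁s₄s₃]`. -/
def atomWord : Fin 3 → List (Fin 4) := ![[0, 1], [1, 0], [0, 3]]

/-- Words for the elements of `[s₁, s₁s₃s₂s₁s₄s₃]` covering the atom `s₁s₃`. -/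
def coverWord : Fin 3 → Fin 2 → List (Fin 4) :=
  ![![[0, 1, 2], [0, 2, 1]], ![[1, 0, 2], [2, 1, 0]], ![[0, 2, 3], [0, 3, 2]]]

theorem length_coverWord (j : Fin 3) (k : Fin 2) :
    cs.length (cs.wordProd (coverWord j k)) = 3 := by
  have h : ∀ j k, (coverWord j k).length = 3 ∧
      3 ≤ (inversions (permOf (coverWord j k))).card := by decide
  obtain ⟨h1, h2⟩ := h j k
  rw [length_wordProd_eq cs (h1 ▸ h2), h1]

theorem coverWord_bruhatLE (j : Fin 3) (k : Fin 2) :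
    BruhatLE cs (cs.wordProd (coverWord j k)) (cs.wordProd [0, 2, 1, 0, 3, 2]) := by
  have h : ∀ j k, ∃ ks ∈ [[1, 2, 2], [3, 3, 3], [0, 0, 2], [0, 3, 3], [3, 2, 3], [0, 0, 0]],
      reducedAlong (n := 4) [0, 2, 1, 0, 3, 2] ks = true ∧
      ks.foldl List.eraseIdx [0, 2, 1, 0, 3, 2] = coverWord j k := by decide
  obtain ⟨ks, -, h1, h2⟩ := h j k
  exact h2 ▸ bruhatLE_of_reducedAlong cs ks h1

theorem atomWord_bruhatLE (j : Fin 3) :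
    BruhatLE cs (cs.wordProd (atomWord j)) (cs.wordProd [0, 2, 1, 0, 3, 2]) := by
  have h : ∀ j, ∃ k, ∃ l < 3, reducedAlong (coverWord j k) [l] = true ∧
      [l].foldl List.eraseIdx (coverWord j k) = atomWord j := by decide
  obtain ⟨k, l, -, h1, h2⟩ := h j
  exact (h2 ▸ bruhatLE_of_reducedAlong cs [l] h1).trans (coverWord_bruhatLE cs j k)

theorem bruhatLE_coverWord (j : Fin 3) (k : Fin 2) :
    BruhatLE cs (cs.wordProd [0, 2]) (cs.wordProd (coverWord j k)) := by
  have h : ∀ j k, ∃ l < 3, reducedAlong (coverWord j k) [l] = true ∧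
      ([l].foldl List.eraseIdx (coverWord j k) = [0, 2] ∨
        [l].foldl List.eraseIdx (coverWord j k) = [2, 0]) := by decide
  obtain ⟨l, -, h1, h2⟩ := h j k
  have := bruhatLE_of_reducedAlong cs [l] h1
  rcases h2 with h2 | h2
  · rwa [h2] at this
  · rwa [h2, wordProd_swap cs (by decide)] at this

theorem simple_bruhatLE_atomWord (j : Fin 3) :
    BruhatLE cs (cs.simple 0) (cs.wordProd (atomWord j)) := by
  have h : ∀ j, ∃ l < 2, reducedAlong (atomWord j) [l] = true ∧
      [l].foldl List.eraseIdx (atomWord j) = [0] := by decide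
  obtain ⟨l, -, h1, h2⟩ := h j
  rw [← cs.wordProd_singleton]
  exact h2 ▸ bruhatLE_of_reducedAlong cs [l] h1

theorem eq_of_bruhatLE_coverWord (j : Fin 3) (k : Fin 2) {z : W}
    (hz : BruhatLE cs (cs.simple 0) z) (hzy : BruhatLE cs z (cs.wordProd (coverWord j k))) :
    z = cs.simple 0 ∨ z = cs.wordProd [0, 2] ∨ z = cs.wordProd (atomWord j) ∨
      z = cs.wordProd (coverWord j k) := by
  have h : ∀ (j : Fin 3) (k : Fin 2) (i i' : Fin 4),
      (permOf [i, i'] * (permOf [0])⁻¹).support.card = 2 →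
      (permOf (coverWord j k) * (permOf [i, i'])⁻¹).support.card = 2 →
      [i, i'] = [0, 2] ∨ [i, i'] = [2, 0] ∨ [i, i'] = atomWord j ∨
        [i, i'] = [3, 0] ∧ atomWord j = [0, 3] := by decide
  rcases exists_word_of_bruhatLE_of_length_eq_three cs (length_coverWord cs j k) hz hzy with
    hz | hz | ⟨i, i', rfl, h1, h2⟩
  · exact .inl hz
  · exact .inr (.inr (.inr hz))
  · rcases h j k i i' h1 h2 with h | h | h | ⟨h, h'⟩
    · exact .inr (.inl (by rw [h]))
    · exact .inr (.inl (by rw [h, wordProd_swap cs (by decide)]))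
    · exact .inr (.inr (.inl (by rw [h])))
    · exact .inr (.inr (.inl (by rw [h, h', wordProd_swap cs (by decide)])))

theorem hasFork_interval :
    HasFork (BruhatInterval cs (cs.simple 0) (cs.wordProd [0, 2, 1, 0, 3, 2])) := by
  have ha : BruhatLE cs (cs.simple 0) (cs.wordProd [0, 2]) := by
    rw [← cs.wordProd_singleton]
    exact bruhatLE_of_reducedAlong cs (ω := [0, 2]) [1] (by decide)
  have hbl (j : Fin 3) : cs.length (cs.wordProd (atomWord j)) ≤ 2 := by
    have h : ∀ j, (atomWord j).length = 2 := by decide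
    exact (cs.length_wordProd_le _).trans (h j).le
  refine ⟨⟨_, .refl, ha.trans ((bruhatLE_coverWord cs 0 0).trans (coverWord_bruhatLE cs 0 0))⟩,
    ⟨_, ha, (bruhatLE_coverWord cs 0 0).trans (coverWord_bruhatLE cs 0 0)⟩,
    fun j ↦ ⟨_, simple_bruhatLE_atomWord cs j, atomWord_bruhatLE cs j⟩,
    fun j k ↦ ⟨_, ha.trans (bruhatLE_coverWord cs j k), coverWord_bruhatLE cs j k⟩,
    fun z ↦ z.2.1, ?_, ?_, ?_, ?_, ?_⟩
  · rw [Ne, Subtype.mk.injEq, ← cs.wordProd_singleton]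
    exact wordProd_ne cs (by decide)
  · exact fun z hz ↦ (eq_or_eq_of_bruhatLE_of_length_le_two cs z.2.1 hz
      (cs.length_wordProd_le _)).imp Subtype.ext Subtype.ext
  · intro j j' h
    have hinj : ∀ j j', permOf (atomWord j) = permOf (atomWord j') → j = j' := by decide
    rw [Subtype.mk.injEq] at h
    by_contra hjj
    exact wordProd_ne cs (mt (hinj j j') hjj) h
  · refine fun j ↦ ⟨?_, fun z hz ↦ (eq_or_eq_of_bruhatLE_of_length_le_two cs z.2.1 hz
      (hbl j)).imp Subtype.ext Subtype.ext⟩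
    have h : ∀ j, permOf (atomWord j) ≠ permOf [0] := by decide
    rw [Ne, Subtype.mk.injEq, ← cs.wordProd_singleton]
    exact wordProd_ne cs (h j)
  · refine fun j ↦ ⟨?_, fun k ↦ ⟨lt_of_le_of_ne (bruhatLE_coverWord cs j k) ?_, fun z hz ↦ ?_⟩⟩
    · have h : ∀ j, permOf (coverWord j 0) ≠ permOf (coverWord j 1) := by decide
      rw [Ne, Subtype.mk.injEq]
      exact wordProd_ne cs (h j)
    · have h : ∀ j k, permOf [0, 2] ≠ permOf (coverWord j k) := by decide
      rw [Ne, Subtype.mk.injEq]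
      exact wordProd_ne cs (h j k)
    · simpa only [Subtype.ext_iff] using eq_of_bruhatLE_coverWord cs j k z.2.1 hz

end PermutationModel

/-- In the symmetric group `S₅` (type `A₄`), the Bruhat interval
`[s₁, s₁s₃s₂s₁s₄s₃]` is not isomorphic, as a poset, to any lower Bruhat interval `[e,x]` in
any symmetric group. -/
theorem interval_not_iso_lower_in_type_A
    {W : Type*} [Group W] (cs : CoxeterSystem (CoxeterMatrix.Aₙ 4) W) :
    ¬ ∃ (D : TypeAData) (x : D.W),
      Nonempty (BruhatInterval cs (cs.simple 0)
          (cs.simple 0 * cs.simple 2 * cs.simple 1 * cs.simple 0 * cs.simple 3 * cs.simple 2)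
        ≃o BruhatInterval D.cs 1 x) := by
  rintro ⟨D, x, ⟨f⟩⟩
  refine not_hasFork_lower D.cs x (HasFork.of_orderIso f ?_)
  rw [show cs.simple 0 * cs.simple 2 * cs.simple 1 * cs.simple 0 * cs.simple 3 * cs.simple 2 =
    cs.wordProd [0, 2, 1, 0, 3, 2] by simp [CoxeterSystem.wordProd, mul_assoc]]
  exact hasFork_interval cs

end Paper
end
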